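/- arXiv:1806.10742 — 2 statements merged into one kernel-verified Lean document; each statement's English description precedes it below -/
import Mathlib

section
/- Let k be a field and B a k-domain with trdeg_k(B) < ∞. Suppose there exist two distinct subrings A₁ ≠ A₂ of B, each algebraically closed in B with B localized at their nonzero elements a polynomial ring in one variable over their fraction field. Then for each such subring A, the field Frac(A) is ruled over k, i.e., there is a field F with k ⊆ F ⊆ Frac(A) and Frac(A) = F(t) purely transcendental of degree 1 over F. -/
/-- The subfield `Frac A` of the fraction field `L` of `B` generated by a subring `A ⊆ B`. -/
def fracField {B L : Type*} [CommRing B] [Field L] [Algebra B L] (A : Subring B) :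
    Subfield L :=
  Subfield.closure ((algebraMap B L) '' A)

/-- `A ∈ 𝒜₁*(B)`: the subring `A` is algebraically closed in `B`, and the localization
`B_A` of `B` at `A \ {0}` (realized inside `L = Frac B` as the subring generated by the
image of `B` together with `Frac A`) is a polynomial ring in one variable over `Frac A`,
i.e. it is generated over `Frac A` by a single element `t` transcendental over `Frac A`. -/
def IsA1Star {B L : Type*} [CommRing B] [Field L] [Algebra B L] (A : Subring B) : Prop :=
  (∀ x : B, (∃ p : Polynomial ↥A, p ≠ 0 ∧ Polynomial.eval₂ A.subtype x p = 0) → x ∈ A) ∧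
  ∃ t : L,
    Subring.closure (Set.range (algebraMap B L) ∪ ((fracField (L := L) A) : Set L)) =
      Subring.closure (((fracField (L := L) A) : Set L) ∪ {t}) ∧
    (∀ p : Polynomial ↥(fracField (L := L) A),
      Polynomial.eval₂ (fracField (L := L) A).subtype t p = 0 → p = 0)

section Auxiliary

open Polynomial

/-- An order function `ord` together with a multiplicative leading coefficient `lc`, with the
formal properties of the order and the leading coefficient of a Laurent series over `R`. -/
structure LeadingTerm (L R : Type*) [Field L] [Field R] where
  ord : L → ℤ
  lc : L →*₀ R
  ord_mul : ∀ {z w : L}, z ≠ 0 → w ≠ 0 → ord (z * w) = ord z + ord w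
  add_of_lt : ∀ {z w : L}, z ≠ 0 → w ≠ 0 → ord z < ord w →
    ord (z + w) = ord z ∧ lc (z + w) = lc z
  add_of_eq : ∀ {z w : L}, z ≠ 0 → w ≠ 0 → ord z = ord w → lc z + lc w ≠ 0 →
    ord (z + w) = ord z ∧ lc (z + w) = lc z + lc w

namespace LeadingTerm

variable {L R : Type*} [Field L] [Field R] (Λ : LeadingTerm L R)

theorem ord_one : Λ.ord 1 = 0 := by
  have := Λ.ord_mul (one_ne_zero (α := L)) one_ne_zero
  simp only [mul_one] at this
  omega

theorem ord_inv {z : L} (hz : z ≠ 0) : Λ.ord z⁻¹ = -Λ.ord z := by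
  have := Λ.ord_mul hz (inv_ne_zero hz)
  rw [mul_inv_cancel₀ hz, ord_one] at this
  omega

theorem ord_pow {z : L} (hz : z ≠ 0) (n : ℕ) : Λ.ord (z ^ n) = n * Λ.ord z := by
  induction n with
  | zero => simp [ord_one]
  | succ n ih => rw [pow_succ, Λ.ord_mul (pow_ne_zero n hz) hz, ih]; push_cast; ring

theorem ord_zpow {z : L} (hz : z ≠ 0) (n : ℤ) : Λ.ord (z ^ n) = n * Λ.ord z := by
  obtain ⟨n, rfl | rfl⟩ := n.eq_nat_or_neg
  · simpa using Λ.ord_pow hz n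
  · rw [zpow_neg, zpow_natCast, Λ.ord_inv (pow_ne_zero n hz), Λ.ord_pow hz]; ring

theorem lc_ne_zero {z : L} (hz : z ≠ 0) : Λ.lc z ≠ 0 := (map_ne_zero Λ.lc).2 hz

/-- The elements whose leading term is, up to a root, the leading term of a power of `y` times
an element of `E`. -/
def IsTame (E : Subfield R) (y z : L) : Prop :=
  z ≠ 0 ∧ Λ.lc z ^ Λ.ord y / Λ.lc y ^ Λ.ord z ∈ E

variable {Λ} {E : Subfield R} {y z w : L}

theorem IsTame.mul (hy : y ≠ 0) (hz : Λ.IsTame E y z) (hw : Λ.IsTame E y w) :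
    Λ.IsTame E y (z * w) := by
  refine ⟨mul_ne_zero hz.1 hw.1, ?_⟩
  have := E.mul_mem hz.2 hw.2
  rwa [div_mul_div_comm, ← mul_zpow, ← zpow_add₀ (Λ.lc_ne_zero hy), ← map_mul,
    ← Λ.ord_mul hz.1 hw.1] at this

theorem IsTame.inv (hz : Λ.IsTame E y z) : Λ.IsTame E y z⁻¹ := by
  refine ⟨inv_ne_zero hz.1, ?_⟩
  have := E.inv_mem hz.2
  rwa [inv_div, ← inv_div_inv, ← inv_zpow, ← map_inv₀, ← zpow_neg, ← Λ.ord_inv hz.1] at this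

theorem isTame_one : Λ.IsTame E y 1 := ⟨one_ne_zero, by simp [Λ.ord_one, E.one_mem]⟩

theorem IsTame.pow (hy : y ≠ 0) (hz : Λ.IsTame E y z) (n : ℕ) : Λ.IsTame E y (z ^ n) := by
  induction n with
  | zero => simpa using isTame_one
  | succ n ih => rw [pow_succ]; exact ih.mul hy hz

theorem IsTame.div (hy : y ≠ 0) (hz : Λ.IsTame E y z) (hw : Λ.IsTame E y w) :
    Λ.IsTame E y (z / w) := by
  rw [div_eq_mul_inv]; exact hz.mul hy hw.inv

end LeadingTerm

theorem Subfield.mem_of_zpow_mem {R : Type*} [Field R] {E : Subfield R}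
    (hE : ∀ r : R, IsAlgebraic E r → r ∈ E) {r : R} {n : ℤ} (hn : n ≠ 0) (h : r ^ n ∈ E) :
    r ∈ E := by
  have key : ∀ m : ℕ, 0 < m → r ^ m ∈ E → r ∈ E := fun m hm h =>
    hE r (IsAlgebraic.of_pow hm (isAlgebraic_algebraMap (⟨_, h⟩ : E)))
  obtain ⟨m, rfl | rfl⟩ := n.eq_nat_or_neg
  · exact key m (by omega) (by simpa using h)
  · exact key m (by omega) (by simpa using E.inv_mem h)

theorem Subfield.exists_eval₂_div_eq {L : Type*} [Field L] {S : Subfield L} {x : L}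
    (hgen : Subfield.closure ((S : Set L) ∪ {x}) = ⊤) (z : L) :
    ∃ p q : S[X], eval₂ S.subtype x p / eval₂ S.subtype x q = z := by
  have key : Subring.closure ((S : Set L) ∪ {x}) ≤ (eval₂RingHom S.subtype x).range := by
    rw [Subring.closure_le]
    rintro a (ha | rfl)
    · exact ⟨C ⟨a, ha⟩, by simp⟩
    · exact ⟨X, by simp⟩
  obtain ⟨a, ha, b, hb, rfl⟩ := Subfield.mem_closure_iff.1 (hgen ▸ Subfield.mem_top z)
  obtain ⟨p, rfl⟩ := key ha
  obtain ⟨q, rfl⟩ := key hb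
  exact ⟨p, q, rfl⟩

namespace LeadingTerm

variable {L R : Type*} [Field L] [Field R] {Λ : LeadingTerm L R}

theorem IsTame.lc_mem {E : Subfield R} (hE : ∀ r : R, IsAlgebraic E r → r ∈ E) {y z : L}
    (hy : Λ.ord y ≠ 0) (hz : Λ.IsTame E y z) (h0 : Λ.ord z = 0) : Λ.lc z ∈ E := by
  have := hz.2
  rw [h0, zpow_zero, div_one] at this
  exact Subfield.mem_of_zpow_mem hE hy this

/-- Suppose that the residue field `R` of a leading-term function on `L = S(x)` is realized by
elements of order zero, and that the residues of the elements of `S` lie in a proper subfield `E`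
which is algebraically closed in `R`. If `S` has an element of nonzero order, then `R` is generated
over `E` by a single element outside `E`. -/
theorem exists_not_mem_closure_eq_top (S : Subfield L) {x : L}
    (hgen : Subfield.closure ((S : Set L) ∪ {x}) = ⊤) {E : Subfield R}
    (hE : ∀ r : R, IsAlgebraic E r → r ∈ E)
    (hS : ∀ a ∈ S, a ≠ 0 → Λ.ord a = 0 → Λ.lc a ∈ E) {y : L} (hyS : y ∈ S) (hy0 : y ≠ 0)
    (hy : Λ.ord y ≠ 0) (hres : ∀ r : R, r ≠ 0 → ∃ z, z ≠ 0 ∧ Λ.ord z = 0 ∧ Λ.lc z = r)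
    (hne : E ≠ ⊤) :
    ∃ ρ, ρ ∉ E ∧ Subfield.closure ((E : Set R) ∪ {ρ}) = ⊤ := by
  classical
  have hTS : ∀ a ∈ S, a ≠ 0 → Λ.IsTame E y a := by
    intro a ha ha0
    refine ⟨ha0, ?_⟩
    have := hS (a ^ Λ.ord y / y ^ Λ.ord a) (S.div_mem (S.zpow_mem ha _) (S.zpow_mem hyS _))
      (div_ne_zero (zpow_ne_zero _ ha0) (zpow_ne_zero _ hy0)) (by
        rw [div_eq_mul_inv, Λ.ord_mul (zpow_ne_zero _ ha0) (inv_ne_zero (zpow_ne_zero _ hy0)),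
          Λ.ord_inv (zpow_ne_zero _ hy0), Λ.ord_zpow ha0, Λ.ord_zpow hy0]
        ring)
    simpa using this
  set ev : S[X] → L := fun p => eval₂ S.subtype x p with hev
  obtain ⟨F, ⟨hF0, hFT⟩, hFmin⟩ : ∃ F : S[X], (ev F ≠ 0 ∧ ¬ Λ.IsTame E y (ev F)) ∧
      ∀ G : S[X], (ev G ≠ 0 ∧ ¬ Λ.IsTame E y (ev G)) → F.natDegree ≤ G.natDegree := by
    have hex : ∃ n, ∃ F : S[X], (ev F ≠ 0 ∧ ¬ Λ.IsTame E y (ev F)) ∧ F.natDegree = n := by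
      by_contra! hcon
      refine hne (eq_top_iff.2 fun r _ => ?_)
      by_cases hr : r = 0
      · rw [hr]; exact E.zero_mem
      obtain ⟨z, hz, ho, rfl⟩ := hres r hr
      obtain ⟨p, q, rfl⟩ := Subfield.exists_eval₂_div_eq hgen z
      rw [div_ne_zero_iff] at hz
      have hall : ∀ F : S[X], ev F ≠ 0 → Λ.IsTame E y (ev F) := fun F hF => by
        by_contra h
        exact hcon _ F ⟨hF, h⟩ rfl
      exact ((hall p hz.1).div hy0 (hall q hz.2)).lc_mem hE hy ho
    obtain ⟨F, hF, hd⟩ := Nat.find_spec hex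
    exact ⟨F, hF, fun G hG => hd ▸ Nat.find_min' hex ⟨G, hG, rfl⟩⟩
  set f := ev F with hf
  have hlow : ∀ G : S[X], G.natDegree < F.natDegree → ev G ≠ 0 → Λ.IsTame E y (ev G) := by
    intro G hG h0
    by_contra h
    exact absurd (hFmin G ⟨h0, h⟩) (by omega)
  have hFdeg : 0 < F.natDegree := by
    by_contra h
    have hc := eq_C_of_natDegree_eq_zero (p := F) (by omega)
    have : ev F = (F.coeff 0 : L) := by
      rw [hev]; dsimp only; rw [hc]; simp
    exact hFT (by rw [hf, this]; exact hTS _ (F.coeff 0).2 (by rwa [← this]))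
  let H : AddSubgroup ℤ :=
    { carrier := {n | ∃ h, Λ.IsTame E y h ∧ Λ.ord h = n * Λ.ord f}
      zero_mem' := ⟨1, isTame_one, by simp [Λ.ord_one]⟩
      add_mem' := by
        rintro a b ⟨h, hh, ha⟩ ⟨h', hh', hb⟩
        exact ⟨h * h', hh.mul hy0 hh', by rw [Λ.ord_mul hh.1 hh'.1, ha, hb]; ring⟩
      neg_mem' := by
        rintro a ⟨h, hh, ha⟩
        exact ⟨h⁻¹, hh.inv, by rw [Λ.ord_inv hh.1, ha]; ring⟩ }
  obtain ⟨e, he0, ⟨h, hhT, hho⟩, hediv⟩ : ∃ e : ℕ, 0 < e ∧ (e : ℤ) ∈ H ∧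
      ∀ n ∈ H, (e : ℤ) ∣ n := by
    obtain ⟨a, ha⟩ := Int.subgroup_cyclic H
    have hdiv : ∀ n, n ∈ H ↔ a ∣ n := by
      intro n
      rw [ha, AddSubgroup.mem_closure_singleton]
      exact ⟨fun ⟨c, hc⟩ => ⟨c, by rw [← hc, smul_eq_mul, mul_comm]⟩,
        fun ⟨c, hc⟩ => ⟨c, by rw [hc, smul_eq_mul, mul_comm]⟩⟩
    have hm : Λ.ord y ∈ H := ⟨y ^ Λ.ord f,
      hTS _ (S.zpow_mem hyS _) (zpow_ne_zero _ hy0), by rw [Λ.ord_zpow hy0]; ring⟩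
    refine ⟨a.natAbs, ?_, ?_, fun n hn => Int.natAbs_dvd.2 ((hdiv n).1 hn)⟩
    · rw [Int.natAbs_pos]
      rintro rfl
      exact hy (zero_dvd_iff.1 ((hdiv _).1 hm))
    · rw [hdiv]; exact Int.dvd_natAbs.2 dvd_rfl
  have hf0 : Λ.lc f ≠ 0 := Λ.lc_ne_zero hF0
  have hh0 : Λ.lc h ≠ 0 := Λ.lc_ne_zero hhT.1
  set ρ := Λ.lc f ^ e / Λ.lc h with hρ
  have hfe : Λ.lc f ^ e = Λ.lc h * ρ := by rw [hρ]; field_simp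
  have hρE : ρ ∉ E := by
    intro hmem
    refine hFT ⟨hF0, Subfield.mem_of_zpow_mem hE (n := e) (by omega) ?_⟩
    have : (Λ.lc f ^ Λ.ord y / Λ.lc y ^ Λ.ord f) ^ (e : ℤ) =
        ρ ^ Λ.ord y * (Λ.lc h ^ Λ.ord y / Λ.lc y ^ Λ.ord h) := by
      rw [hho, mul_div_assoc', ← mul_zpow, mul_comm ρ, ← hfe, div_zpow, ← zpow_mul, ← zpow_mul,
        ← zpow_natCast, ← zpow_mul, mul_comm (e : ℤ), mul_comm (e : ℤ)]
    rw [this]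
    exact E.mul_mem (E.zpow_mem hmem _) hhT.2
  have hρtr : ∀ P : E[X], eval₂ E.subtype ρ P = 0 → P = 0 := by
    intro P hP
    by_contra hP0
    exact hρE (hE ρ ⟨P, hP0, hP⟩)
  have hpow : ∀ (g : L) (j : ℤ), Λ.IsTame E y g → Λ.ord g + j * Λ.ord f = 0 →
      ∃ (c : R) (s : ℤ), c ∈ E ∧ j = e * s ∧ Λ.lc g * Λ.lc f ^ j = c * ρ ^ s := by
    intro g j hg hj
    obtain ⟨s, rfl⟩ := hediv j ⟨g⁻¹, hg.inv, by rw [Λ.ord_inv hg.1]; linarith⟩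
    have hhs : Λ.IsTame E y (h ^ s) := by
      obtain ⟨n, rfl | rfl⟩ := s.eq_nat_or_neg
      · simpa using hhT.pow hy0 n
      · simpa using (hhT.pow hy0 n).inv
    refine ⟨Λ.lc (g * h ^ s), s, (hg.mul hy0 hhs).lc_mem hE hy ?_, rfl, ?_⟩
    · rw [Λ.ord_mul hg.1 hhs.1, Λ.ord_zpow hhT.1, hho, ← hj]; ring
    · rw [zpow_mul, zpow_natCast, hfe, mul_zpow, map_mul, map_zpow₀, mul_assoc]
  have hgood : ∀ (n : ℕ) (p : S[X]), p.natDegree < n → ev p ≠ 0 →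
      ∃ (g : L) (i : ℕ) (P : E[X]), Λ.IsTame E y g ∧ eval₂ E.subtype ρ P ≠ 0 ∧
        Λ.ord (ev p) = Λ.ord g + i * Λ.ord f ∧
        Λ.lc (ev p) = Λ.lc g * Λ.lc f ^ i * eval₂ E.subtype ρ P := by
    intro n
    induction n with
    | zero => intro p hp; omega
    | succ n ih =>
      intro p hpn hp0
      by_cases hlt : p.natDegree < F.natDegree
      · exact ⟨ev p, 0, 1, hlow p hlt hp0, by simp, by simp, by simp⟩
      have hdm : p = F * (p / F) + p % F := (EuclideanDomain.div_add_mod p F).symm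
      have hevp : ev p = f * ev (p / F) + ev (p % F) := by
        conv_lhs => rw [hdm]
        simp only [hev, hf, eval₂_add, eval₂_mul]
      have hr : ev (p % F) ≠ 0 → Λ.IsTame E y (ev (p % F)) := hlow _ (natDegree_mod_lt _ (by omega))
      have hq : (p / F).natDegree < n := by
        by_cases hq0 : p / F = 0
        · rw [hq0, natDegree_zero]; omega
        · have := natDegree_lt_natDegree hq0 (degree_div_lt (by rintro rfl; simp at hq0)
            (natDegree_pos_iff_degree_pos.1 hFdeg))
          omega
      by_cases hq0 : ev (p / F) = 0
      · rw [hq0, mul_zero, zero_add] at hevp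
        rw [hevp] at hp0 ⊢
        exact ⟨_, 0, 1, hr hp0, by simp, by simp, by simp⟩
      obtain ⟨g, i, P, hg, hP, hog, hlg⟩ := ih _ hq hq0
      have hfq : f * ev (p / F) ≠ 0 := mul_ne_zero hF0 hq0
      have hofq : Λ.ord (f * ev (p / F)) = Λ.ord g + (i + 1 : ℕ) * Λ.ord f := by
        rw [Λ.ord_mul hF0 hq0, hog]; push_cast; ring
      have hlfq : Λ.lc (f * ev (p / F)) = Λ.lc g * Λ.lc f ^ (i + 1) * eval₂ E.subtype ρ P := by
        rw [map_mul, hlg]; ring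
      by_cases hr0 : ev (p % F) = 0
      · rw [hevp, hr0, add_zero]
        exact ⟨g, i + 1, P, hg, hP, hofq, hlfq⟩
      rcases lt_trichotomy (Λ.ord (f * ev (p / F))) (Λ.ord (ev (p % F))) with hlt' | heq | hgt
      · obtain ⟨h1, h2⟩ := Λ.add_of_lt hfq hr0 hlt'
        rw [hevp, h1, h2]
        exact ⟨g, i + 1, P, hg, hP, hofq, hlfq⟩
      · obtain ⟨c, s, hc, hs, hcs⟩ := hpow (g / ev (p % F)) (i + 1 : ℕ)
          (hg.div hy0 (hr hr0)) (by
            rw [div_eq_mul_inv, Λ.ord_mul hg.1 (inv_ne_zero hr0), Λ.ord_inv hr0]; linarith)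
        have hspos : 0 < s := by
          have : (0 : ℤ) < e * s := by rw [← hs]; positivity
          exact pos_of_mul_pos_right this (by positivity)
        lift s to ℕ using hspos.le
        rw [zpow_natCast, zpow_natCast, map_div₀] at hcs
        have hlr := Λ.lc_ne_zero hr0
        have hQ : eval₂ E.subtype ρ (1 + C ⟨c, hc⟩ * X ^ s * P) =
            1 + c * ρ ^ s * eval₂ E.subtype ρ P := by simp [eval₂_mul]
        have hQ0 : eval₂ E.subtype ρ (1 + C ⟨c, hc⟩ * X ^ s * P) ≠ 0 := by
          intro h0
          have := congrArg (coeff · 0) (hρtr _ h0)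
          simp only [coeff_add, coeff_one_zero, mul_coeff_zero, coeff_X_pow,
            if_neg (by omega : ¬ 0 = s), mul_zero, zero_mul, add_zero, coeff_zero,
            one_ne_zero] at this
        have hsum : Λ.lc (f * ev (p / F)) + Λ.lc (ev (p % F)) =
            Λ.lc (ev (p % F)) * eval₂ E.subtype ρ (1 + C ⟨c, hc⟩ * X ^ s * P) := by
          rw [hQ, hlfq, ← hcs]; field_simp; ring
        obtain ⟨h1, h2⟩ := Λ.add_of_eq hfq hr0 heq (by rw [hsum]; exact mul_ne_zero hlr hQ0)
        rw [hevp, h1, h2, hsum, heq]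
        exact ⟨_, 0, _, hr hr0, hQ0, by simp, by simp⟩
      · obtain ⟨h1, h2⟩ := Λ.add_of_lt hr0 hfq hgt
        rw [hevp, add_comm, h1, h2]
        exact ⟨_, 0, 1, hr hr0, by simp, by simp, by simp⟩
  refine ⟨ρ, hρE, eq_top_iff.2 fun r _ => ?_⟩
  have hEcl : E ≤ Subfield.closure ((E : Set R) ∪ {ρ}) := fun a ha =>
    Subfield.subset_closure (Or.inl ha)
  have hρcl : ρ ∈ Subfield.closure ((E : Set R) ∪ {ρ}) := Subfield.subset_closure (Or.inr rfl)
  have hPcl : ∀ P : E[X], eval₂ E.subtype ρ P ∈ Subfield.closure ((E : Set R) ∪ {ρ}) := by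
    intro P
    rw [eval₂_eq_sum]
    exact sum_mem fun i _ => mul_mem (hEcl (P.coeff i).2) (pow_mem hρcl _)
  by_cases hr : r = 0
  · rw [hr]; exact zero_mem _
  obtain ⟨z, hz, ho, rfl⟩ := hres r hr
  obtain ⟨p, q, rfl⟩ := Subfield.exists_eval₂_div_eq hgen z
  rw [div_ne_zero_iff] at hz
  change Λ.lc (ev p / ev q) ∈ _
  change Λ.ord (ev p / ev q) = _ at ho
  obtain ⟨g, i, P, hg, hP, hog, hlg⟩ := hgood _ p (Nat.lt_succ_self _) hz.1
  obtain ⟨g', i', P', hg', hP', hog', hlg'⟩ := hgood _ q (Nat.lt_succ_self _) hz.2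
  rw [div_eq_mul_inv, Λ.ord_mul hz.1 (inv_ne_zero hz.2), Λ.ord_inv hz.2, hog, hog'] at ho
  obtain ⟨c, s, hc, -, hcs⟩ := hpow (g / g') (i - i') (hg.div hy0 hg') (by
    rw [div_eq_mul_inv, Λ.ord_mul hg.1 hg'.inv.1, Λ.ord_inv hg'.1]; linarith)
  have : Λ.lc (ev p / ev q) =
      (c * ρ ^ s) * (eval₂ E.subtype ρ P / eval₂ E.subtype ρ P') := by
    rw [← hcs, zpow_sub₀ hf0, map_div₀, map_div₀, hlg, hlg', zpow_natCast, zpow_natCast]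
    have := Λ.lc_ne_zero hg'.1
    field_simp
  rw [this]
  exact mul_mem (mul_mem (hEcl hc) (zpow_mem hρcl _)) (div_mem (hPcl _) (hPcl _))

end LeadingTerm

open scoped LaurentSeries in
/-- The order and leading coefficient of the Laurent series `φ z`. -/
noncomputable def LeadingTerm.ofRingHom {L R : Type*} [Field L] [Field R] (φ : L →+* R⸨X⸩) :
    LeadingTerm L R where
  ord z := (φ z).order
  lc :=
    { toFun := fun z => (φ z).leadingCoeff
      map_zero' := by simp
      map_one' := by simp
      map_mul' := fun z w => by simp [HahnSeries.leadingCoeff_mul] }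
  ord_mul {z w} hz hw := by
    rw [map_mul, HahnSeries.order_mul ((map_ne_zero φ).2 hz) ((map_ne_zero φ).2 hw)]
  add_of_lt {z w} hz hw h := by
    have hz' := (map_ne_zero φ).2 hz
    have hw' := (map_ne_zero φ).2 hw
    have hlt : (φ z).orderTop < (φ w).orderTop := by
      rw [← HahnSeries.order_eq_orderTop_of_ne_zero hz',
        ← HahnSeries.order_eq_orderTop_of_ne_zero hw']
      exact_mod_cast h
    have h1 := HahnSeries.orderTop_add_eq_left hlt
    have h2 : φ z + φ w ≠ 0 := by
      rw [← HahnSeries.orderTop_ne_top, h1]; exact HahnSeries.orderTop_ne_top.2 hz'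
    refine ⟨?_, ?_⟩
    · rw [map_add]
      rw [← HahnSeries.order_eq_orderTop_of_ne_zero h2,
        ← HahnSeries.order_eq_orderTop_of_ne_zero hz'] at h1
      exact_mod_cast h1
    · change (φ (z + w)).leadingCoeff = (φ z).leadingCoeff
      rw [map_add, HahnSeries.leadingCoeff_add_eq_left hlt]
  add_of_eq {z w} hz hw h hne := by
    change (φ z).leadingCoeff + (φ w).leadingCoeff ≠ 0 at hne
    change (φ (z + w)).order = (φ z).order ∧
      (φ (z + w)).leadingCoeff = (φ z).leadingCoeff + (φ w).leadingCoeff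
    rw [HahnSeries.leadingCoeff_eq, HahnSeries.leadingCoeff_eq, ← h, ← HahnSeries.coeff_add,
      ← map_add] at hne
    have h0 : φ z + φ w ≠ 0 := by
      intro h0
      rw [map_add, h0] at hne
      simp at hne
    have ho : (φ (z + w)).order = (φ z).order := by
      refine le_antisymm (HahnSeries.order_le_of_coeff_ne_zero hne) ?_
      have := HahnSeries.min_order_le_order_add h0
      rwa [← h, min_self, ← map_add] at this
    refine ⟨ho, ?_⟩
    rw [HahnSeries.leadingCoeff_eq, HahnSeries.leadingCoeff_eq, HahnSeries.leadingCoeff_eq, ho, ← h,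
      map_add, HahnSeries.coeff_add]

open scoped LaurentSeries in
theorem algebraMap_laurentSeries {K : Type*} [Field K] (c : K) :
    algebraMap K K⸨X⸩ c = HahnSeries.C c := by
  rw [HahnSeries.algebraMap_apply', PowerSeries.algebraMap_apply, Algebra.algebraMap_self_apply,
    HahnSeries.ofPowerSeries_C]

open scoped LaurentSeries IntermediateField RatFunc in
/-- The expansion at infinity of the elements of a simple transcendental extension. -/
theorem exists_algHom_laurentSeries {K L : Type*} [Field K] [Field L] [Algebra K L] {t : L}
    (ht : Transcendental K t) (hK : K⟮t⟯ = ⊤) :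
    ∃ φ : L →ₐ[K] K⸨X⸩, φ t = HahnSeries.single (-1) 1 := by
  have ht' : Transcendental K t⁻¹ := fun h => ht (IsAlgebraic.inv_iff.1 h)
  have hK' : K⟮t⁻¹⟯ = ⊤ := by
    rw [eq_top_iff, ← hK, IntermediateField.adjoin_simple_le_iff]
    simpa using inv_mem (IntermediateField.mem_adjoin_simple_self K t⁻¹)
  let e : RatFunc K ≃ₐ[K] L := (RatFunc.algEquivOfTranscendental t⁻¹ ht').trans
    ((IntermediateField.equivOfEq hK').trans IntermediateField.topEquiv)
  have he : e.symm t⁻¹ = RatFunc.X := by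
    rw [AlgEquiv.symm_apply_eq]
    simp [e]
  let ψ : RatFunc K →ₐ[K] K⸨X⸩ :=
    { algebraMap (RatFunc K) K⸨X⸩ with
      commutes' := fun c => by
        change algebraMap (RatFunc K) K⸨X⸩ (algebraMap K (RatFunc K) c) = _
        rw [algebraMap_laurentSeries, IsScalarTower.algebraMap_apply K K[X] (RatFunc K) c,
          ← IsScalarTower.algebraMap_apply K[X] (RatFunc K) K⸨X⸩]
        simp }
  have hψ : ψ RatFunc.X = HahnSeries.single 1 1 := RatFunc.coe_X
  refine ⟨ψ.comp e.symm.toAlgHom, ?_⟩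
  have h1 : t = (t⁻¹)⁻¹ := (inv_inv t).symm
  have h2 : e.symm t = RatFunc.X⁻¹ := by
    rw [h1, map_inv₀, he]
  simp [h2, hψ]

open scoped LaurentSeries in
theorem order_neg_of_notMem_range {K L : Type*} [Field K] [Field L] [Algebra K L]
    {t : L} {φ : L →ₐ[K] K⸨X⸩} (hφ : φ t = HahnSeries.single (-1) 1) {p : K[X]}
    (hp : aeval t p ∉ Set.range (algebraMap K L)) : (φ (aeval t p)).order < 0 := by
  have hdeg : 0 < p.natDegree := by
    by_contra h
    rw [eq_C_of_natDegree_eq_zero (p := p) (by omega)] at hp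
    simp at hp
  have hcoeff : (φ (aeval t p)).coeff (-(p.natDegree : ℤ)) = p.leadingCoeff := by
    rw [← aeval_algHom_apply, hφ, aeval_def, eval₂_eq_sum_range, HahnSeries.coeff_sum]
    simp only [algebraMap_laurentSeries, HahnSeries.C_mul_eq_smul, HahnSeries.coeff_smul,
      smul_eq_mul]
    rw [Finset.sum_eq_single p.natDegree]
    · simp
    · intro i _ hi
      simp [HahnSeries.coeff_single_of_ne (show -(p.natDegree : ℤ) ≠ -i by omega)]
    · simp
  have := HahnSeries.order_le_of_coeff_ne_zero (x := φ (aeval t p)) (g := -(p.natDegree : ℤ))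
    (by rw [hcoeff]; exact leadingCoeff_ne_zero.2 (by rintro rfl; simp at hdeg))
  omega

open scoped IntermediateField in
theorem trdeg_eq_one_of_adjoin_simple_eq_top {K L : Type*} [Field K] [Field L] [Algebra K L]
    {t : L} (ht : Transcendental K t) (hK : K⟮t⟯ = ⊤) : Algebra.trdeg K L = 1 := by
  have hb : IsTranscendenceBasis K ((↑) : ({t} : Set L) → L) := by
    rw [isTranscendenceBasis_iff_algebraicIndependent_isAlgebraic]
    refine ⟨(algebraicIndependent_singleton_iff ⟨t, rfl⟩).2 ht, ?_⟩
    rw [Subtype.range_coe]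
    refine ⟨fun z => ?_⟩
    open scoped IntermediateField.algebraAdjoinAdjoin in
    rw [IsFractionRing.isAlgebraic_iff (Algebra.adjoin K {t}) K⟮t⟯ L]
    exact isAlgebraic_algebraMap (⟨z, hK ▸ trivial⟩ : K⟮t⟯)
  simpa using hb.cardinalMk_eq_trdeg.symm

theorem AlgebraicIndependent.option_of_algHom {k P R ι : Type*} [CommRing k] [CommRing P]
    [IsDomain P] [CommRing R] [Algebra k P] [Algebra k R] (π : P →ₐ[k] R) {w : ι → P}
    (hw : AlgebraicIndependent k (π ∘ w)) {v : P} (hv0 : v ≠ 0) (hv : π v = 0) :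
    AlgebraicIndependent k (fun o : Option ι => o.elim v w) := by
  have hw' : AlgebraicIndependent k w := hw.of_comp π
  rw [hw'.option_iff_transcendental]
  intro halg
  obtain ⟨q, hq0, hq⟩ := halg.exists_nonzero_coeff_and_aeval_eq_zero
    (mem_nonZeroDivisors_of_ne_zero hv0)
  obtain ⟨p, hp⟩ : ∃ p : MvPolynomial ι k, MvPolynomial.aeval w p = (q.coeff 0 : P) :=
    (Algebra.adjoin_range_eq_range_aeval k w).le (q.coeff 0).2
  have h1 : aeval v q.divX * v + (q.coeff 0 : P) = 0 := by
    rw [← hq]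
    conv_rhs => rw [← divX_mul_X_add q]
    rw [map_add, map_mul, aeval_X, aeval_C]
    rfl
  have h2 := congrArg π h1
  rw [map_add, map_mul, hv, mul_zero, zero_add, map_zero, ← hp, MvPolynomial.comp_aeval_apply]
    at h2
  have h3 : p = 0 := hw.eq_zero_of_aeval_eq_zero p h2
  exact hq0 (Subtype.ext (by rw [← hp, h3]; simp))

open scoped LaurentSeries in
/-- The constant coefficient is an algebra homomorphism on the elements of order at least zero. -/
theorem exists_residue_algHom {k K L : Type*} [Field k] [Field K] [Field L] [Algebra k K]
    [Algebra k L] [Algebra K L] [IsScalarTower k K L] (φ : L →ₐ[K] K⸨X⸩) :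
    ∃ (V : Subalgebra k L) (π : V →ₐ[k] K),
      ∀ z, 0 ≤ (φ z).order → ∃ h : z ∈ V, π ⟨z, h⟩ = (φ z).coeff 0 := by
  have hk : ∀ c : k, φ (algebraMap k L c) =
      HahnSeries.ofPowerSeries ℤ K (PowerSeries.C (algebraMap k K c)) := fun c => by
    rw [IsScalarTower.algebraMap_apply k K L, AlgHom.commutes, algebraMap_laurentSeries,
      HahnSeries.ofPowerSeries_C]
  have h0 : ∀ f : PowerSeries K, (HahnSeries.ofPowerSeries ℤ K f).coeff 0 =
      PowerSeries.constantCoeff f := fun f => by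
    simpa using LaurentSeries.coeff_coe_powerSeries f 0
  let V : Subalgebra k L :=
    { (HahnSeries.ofPowerSeries ℤ K).range.comap φ.toRingHom with
      algebraMap_mem' := fun c => ⟨_, (hk c).symm⟩ }
  have hV : ∀ z : V, ∃ f, HahnSeries.ofPowerSeries ℤ K f = φ z := fun z => z.2
  let π : V →ₐ[k] K :=
    { toFun := fun z => (φ z).coeff 0
      map_zero' := by simp
      map_one' := by simp
      map_add' := by simp
      map_mul' := fun z w => by
        obtain ⟨f, hf⟩ := hV z
        obtain ⟨g, hg⟩ := hV w
        rw [MulMemClass.coe_mul, map_mul, ← hf, ← hg, ← map_mul, h0, h0, h0, map_mul]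
      commutes' := fun c => by
        change (φ (algebraMap k L c)).coeff 0 = _
        rw [hk, h0, PowerSeries.constantCoeff_C] }
  refine ⟨V, π, fun z hz => ⟨?_, rfl⟩⟩
  lift (φ z).order to ℕ using hz with n hn
  exact ⟨_, LaurentSeries.X_order_mul_powerSeriesPart hn⟩

open scoped LaurentSeries in
theorem order_laurentSeries_C {K L : Type*} [Field K] [Field L] [Algebra K L]
    (φ : L →ₐ[K] K⸨X⸩) (a : K) : (φ (algebraMap K L a)).order = 0 := by
  rw [AlgHom.commutes, algebraMap_laurentSeries, HahnSeries.order_C]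

open scoped IntermediateField in
theorem IntermediateField.closure_union_singleton_eq_top {k L : Type*} [Field k] [Field L]
    [Algebra k L] {K : IntermediateField k L} {t : L} (hK : K⟮t⟯ = ⊤) :
    Subfield.closure ((K.toSubfield : Set L) ∪ {t}) = ⊤ := by
  have h := congrArg IntermediateField.toSubfield hK
  rw [IntermediateField.adjoin_toSubfield] at h
  have hr : Set.range (algebraMap K L) = K := Subtype.range_coe
  rwa [hr] at h

open scoped IntermediateField in
/-- If `L = K(t) = K'(t')` has finite transcendence degree over `k` and `K[t]` meets `K'` outside
`K`, then `K` is purely transcendental of degree one over a subfield containing `k`. -/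
theorem IntermediateField.exists_ruled {k L : Type*} [Field k] [Field L] [Algebra k L]
    (hfin : Algebra.trdeg k L < Cardinal.aleph0) (K K' : IntermediateField k L) {t t' : L}
    (ht : Transcendental K t) (ht' : Transcendental K' t') (hK : K⟮t⟯ = ⊤) (hK' : K'⟮t'⟯ = ⊤)
    {p : K[X]} (hpK' : aeval t p ∈ K') (hpK : aeval t p ∉ K) :
    ∃ E : Subfield K, (∀ c : k, algebraMap k K c ∈ E) ∧
      ∃ ρ : K, Transcendental E ρ ∧ Subfield.closure ((E : Set K) ∪ {ρ}) = ⊤ := by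
  obtain ⟨φ, hφ⟩ := exists_algHom_laurentSeries ht hK
  set Λ := LeadingTerm.ofRingHom φ.toRingHom
  set y := aeval t p
  have hord : ∀ z, Λ.ord z = (φ z).order := fun _ => rfl
  have hlc : ∀ z, Λ.lc z = (φ z).leadingCoeff := fun _ => rfl
  have hy : Λ.ord y < 0 := order_neg_of_notMem_range hφ (by
    rintro ⟨a, ha⟩
    exact hpK (by rw [show y = a from ha.symm]; exact a.2))
  have hy0 : y ≠ 0 := fun h => hpK (h ▸ K.zero_mem)
  set G : Set K := {r | ∃ a ∈ K', a ≠ 0 ∧ Λ.ord a = 0 ∧ Λ.lc a = r}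
  set M := IntermediateField.adjoin k G
  set E : Subfield K := (algebraicClosure M K).toSubfield
  have hmemE : ∀ r, r ∈ E ↔ IsAlgebraic M r := fun r => mem_algebraicClosure_iff
  have hEcl : ∀ r : K, IsAlgebraic E r → r ∈ E := by
    intro r hr
    have hr' : IsAlgebraic (algebraicClosure M K) r := hr
    exact (hmemE r).2 (hr'.restrictScalars M)
  have hEtop : E ≠ ⊤ := by
    intro htop
    have halg : Algebra.IsAlgebraic (Algebra.adjoin k G) K := by
      refine ⟨fun r => ?_⟩
      open scoped IntermediateField.algebraAdjoinAdjoin in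
      rw [IsFractionRing.isAlgebraic_iff (Algebra.adjoin k G) M K]
      exact (hmemE r).1 (htop ▸ Subfield.mem_top r)
    obtain ⟨s, hsG, hs⟩ := exists_isTranscendenceBasis_subset (R := k) G
    choose b hbK' hb0 hbo hbl using fun x : s => hsG x.2
    obtain ⟨V, π, hπ⟩ := exists_residue_algHom (k := k) φ
    choose hbV hbπ using fun x : s => hπ (b x) (hbo x).ge
    have hyo : 0 < Λ.ord y⁻¹ := by rw [Λ.ord_inv hy0]; omega
    obtain ⟨hyV, hyπ⟩ := hπ y⁻¹ hyo.le
    have hind : AlgebraicIndependent k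
        (fun o : Option s => o.elim (⟨y⁻¹, hyV⟩ : V) (fun x => ⟨b x, hbV x⟩)) := by
      refine AlgebraicIndependent.option_of_algHom π ?_ ?_ ?_
      · convert hs.1
        ext1 x
        rw [Function.comp_apply, hbπ, ← hbl x, hlc, HahnSeries.leadingCoeff_eq, ← hord, hbo]
      · simpa [Subtype.ext_iff] using hy0
      · rw [hyπ]
        exact HahnSeries.coeff_eq_zero_of_lt_order hyo
    have hind' : AlgebraicIndependent k
        (fun o : Option s => o.elim (⟨y⁻¹, K'.inv_mem hpK'⟩ : K') (fun x => ⟨b x, hbK' x⟩)) := by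
      refine AlgebraicIndependent.of_comp K'.val ?_
      convert hind.map' (f := V.val) Subtype.val_injective using 1
      ext o
      cases o <;> rfl
    have h1 := hind'.cardinalMk_le_trdeg
    have h2 := hs.cardinalMk_eq_trdeg
    rw [Cardinal.mk_option, h2] at h1
    have h3 := trdeg_add_eq k K (A := L)
    have h4 := trdeg_add_eq k K' (A := L)
    rw [trdeg_eq_one_of_adjoin_simple_eq_top ht hK] at h3
    rw [trdeg_eq_one_of_adjoin_simple_eq_top ht' hK'] at h4
    rw [← h3] at h4 hfin
    have hfin' := hfin
    rw [← h4] at hfin'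
    lift Algebra.trdeg k K to ℕ using (self_le_add_right _ _).trans_lt hfin with m
    lift Algebra.trdeg k K' to ℕ using (self_le_add_right _ _).trans_lt hfin' with n
    norm_cast at h1 h4
    omega
  obtain ⟨ρ, hρ, hgen⟩ := LeadingTerm.exists_not_mem_closure_eq_top (Λ := Λ) K'.toSubfield
    (x := t') (closure_union_singleton_eq_top hK') hEcl
    (fun a ha ha0 hao => (hmemE _).2 (isAlgebraic_algebraMap
      (⟨_, IntermediateField.subset_adjoin k G ⟨a, ha, ha0, hao, rfl⟩⟩ : M)))
    hpK' hy0 hy.ne (fun r hr => ⟨algebraMap K L r, by simpa using hr, by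
      rw [hord, order_laurentSeries_C], by
      rw [hlc, AlgHom.commutes, algebraMap_laurentSeries, HahnSeries.C_apply,
        HahnSeries.leadingCoeff_of_single]⟩) hEtop
  refine ⟨E, fun c => (hmemE _).2 (isAlgebraic_algebraMap (algebraMap k M c)), ρ,
    fun h => hρ (hEcl ρ h), hgen⟩

open scoped IntermediateField in
theorem isAlgebraic_of_adjoin_simple_eq_top {K K' L : Type*} [Field K] [Field K'] [Field L]
    [Algebra K L] [Algebra K' L] [Algebra K' K] [IsScalarTower K' K L] {t t' : L}
    (ht' : Transcendental K' t') (hK' : K'⟮t'⟯ = ⊤) (ht : Transcendental K t) (hK : K⟮t⟯ = ⊤) :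
    Algebra.IsAlgebraic K' K := by
  have h := lift_trdeg_add_eq K' K L
  rw [trdeg_eq_one_of_adjoin_simple_eq_top ht hK,
    trdeg_eq_one_of_adjoin_simple_eq_top ht' hK', Cardinal.lift_one] at h
  rw [← trdeg_eq_zero_iff, ← Cardinal.lift_eq_zero]
  exact Cardinal.add_one_inj.1 (h.trans (zero_add 1).symm)

open scoped IntermediateField in
theorem Subfield.isAlgebraic_of_mem_of_le {L : Type*} [Field L] {K' K : Subfield L} (hle : K' ≤ K)
    {t t' : L} (ht' : Transcendental K' t') (hK' : K'⟮t'⟯ = ⊤) (ht : Transcendental K t)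
    (hK : K⟮t⟯ = ⊤) (x : L) (hx : x ∈ K) : IsAlgebraic K' x := by
  let : Algebra K' K := (Subfield.inclusion hle).toAlgebra
  have : IsScalarTower K' K L := IsScalarTower.of_algebraMap_eq fun _ => rfl
  have := isAlgebraic_of_adjoin_simple_eq_top ht' hK' ht hK
  exact (Algebra.IsAlgebraic.isAlgebraic (R := K') (⟨x, hx⟩ : K)).algebraMap

section IsA1Star

variable {B L : Type*} [CommRing B] [Field L] [Algebra B L] {A A' : Subring B}

theorem algebraMap_mem_fracField {a : B} (ha : a ∈ A) : algebraMap B L a ∈ fracField (L := L) A :=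
  Subfield.subset_closure ⟨a, ha, rfl⟩

theorem exists_div_eq_of_mem_fracField {z : L} (hz : z ∈ fracField (L := L) A) :
    ∃ a ∈ A, ∃ b ∈ A, algebraMap B L a / algebraMap B L b = z := by
  obtain ⟨x, hx, y, hy, rfl⟩ := Subfield.mem_closure_iff.1 hz
  have h : Subring.closure ((algebraMap B L) '' A) = A.map (algebraMap B L) := by
    rw [← Subring.coe_map, Subring.closure_eq]
  rw [h] at hx hy
  obtain ⟨a, ha, rfl⟩ := hx
  obtain ⟨b, hb, rfl⟩ := hy
  exact ⟨a, ha, b, hb, rfl⟩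

variable [IsFractionRing B L]

open scoped IntermediateField in
theorem IsA1Star.exists_transcendental (hA : IsA1Star (L := L) A) :
    ∃ t : L, Transcendental (fracField (L := L) A) t ∧ (fracField (L := L) A)⟮t⟯ = ⊤ ∧
      ∀ b : B, ∃ p : (fracField (L := L) A)[X], aeval t p = algebraMap B L b := by
  obtain ⟨-, t, hcl, ht⟩ := hA
  have hpoly : ∀ b : B, ∃ p : (fracField (L := L) A)[X], aeval t p = algebraMap B L b := by
    intro b
    have hb : algebraMap B L b ∈ Subring.closure ((fracField (L := L) A : Set L) ∪ {t}) :=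
      hcl ▸ Subring.subset_closure (Or.inl ⟨b, rfl⟩)
    have hle : Subring.closure ((fracField (L := L) A : Set L) ∪ {t}) ≤
        (aeval (R := fracField (L := L) A) t).toRingHom.range := by
      rw [Subring.closure_le]
      rintro a (ha | rfl)
      · exact ⟨C ⟨a, ha⟩, aeval_C _ _⟩
      · exact ⟨X, aeval_X _⟩
    exact hle hb
  refine ⟨t, fun ⟨p, hp0, hp⟩ => hp0 (ht p hp), eq_top_iff.2 fun z _ => ?_, hpoly⟩
  obtain ⟨a, b, -, rfl⟩ := IsFractionRing.div_surjective (A := B) z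
  have hmem : ∀ b : B, algebraMap B L b ∈ (fracField (L := L) A)⟮t⟯ := fun b => by
    obtain ⟨p, hp⟩ := hpoly b
    rw [← hp]
    exact IntermediateField.algebra_adjoin_le_adjoin _ _ (aeval_mem_adjoin_singleton _ t)
  exact div_mem (hmem a) (hmem b)

theorem IsA1Star.mem_fracField_of_mul_eq_one (hA : IsA1Star (L := L) A) {b c : B}
    (h : b * c = 1) : algebraMap B L b ∈ fracField (L := L) A := by
  obtain ⟨t, ht, -, hpoly⟩ := hA.exists_transcendental
  obtain ⟨p, hp⟩ := hpoly b
  obtain ⟨q, hq⟩ := hpoly c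
  have hpq : p * q = 1 := by
    refine transcendental_iff_injective.1 ht ?_
    rw [map_mul, hp, hq, ← map_mul, h, map_one, map_one]
  obtain ⟨r, -, rfl⟩ := isUnit_iff.1 (IsUnit.of_mul_eq_one q hpq)
  rw [← hp, aeval_C]
  exact r.2

variable [IsDomain B]

theorem IsA1Star.mem_of_isAlgebraic (hA : IsA1Star (L := L) A) {b : B}
    (hb : IsAlgebraic (fracField (L := L) A) (algebraMap B L b)) : b ∈ A := by
  let i : A →+* fracField (L := L) A := ((algebraMap B L).comp A.subtype).codRestrict _
    fun a => algebraMap_mem_fracField a.2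
  let : Algebra A (fracField (L := L) A) := i.toAlgebra
  have hinj := IsFractionRing.injective B L
  have : IsScalarTower A (fracField (L := L) A) L := IsScalarTower.of_algebraMap_eq fun _ => rfl
  have : FaithfulSMul A (fracField (L := L) A) := by
    rw [faithfulSMul_iff_algebraMap_injective]
    exact fun x y h => Subtype.ext (hinj (congrArg Subtype.val h))
  have : IsFractionRing A (fracField (L := L) A) := by
    refine IsFractionRing.of_field A _ fun z => ?_
    obtain ⟨a, ha, b, hb, h⟩ := exists_div_eq_of_mem_fracField z.2
    exact ⟨⟨a, ha⟩, ⟨b, hb⟩, Subtype.ext h.symm⟩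
  rw [← IsFractionRing.isAlgebraic_iff A (fracField (L := L) A) L] at hb
  obtain ⟨p, hp0, hp⟩ := hb
  refine hA.1 b ⟨p, hp0, hinj ?_⟩
  rw [map_zero, ← hp, hom_eval₂]
  rfl

theorem IsA1Star.eq_of_le (hA : IsA1Star (L := L) A) (hA' : IsA1Star (L := L) A') (h : A' ≤ A) :
    A' = A := by
  obtain ⟨t, ht, htop, -⟩ := hA.exists_transcendental
  obtain ⟨t', ht', htop', -⟩ := hA'.exists_transcendental
  have hle : fracField (L := L) A' ≤ fracField (L := L) A :=
    Subfield.closure_mono (Set.image_mono h)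
  have halg := Subfield.isAlgebraic_of_mem_of_le hle ht' htop' ht htop
  exact le_antisymm h fun a ha =>
    hA'.mem_of_isAlgebraic (L := L) (halg _ (algebraMap_mem_fracField ha))

end IsA1Star

section Ruled

variable {k B L : Type*} [Field k] [CommRing B] [IsDomain B] [Algebra k B]
  [Field L] [Algebra B L] [IsFractionRing B L]

theorem trdeg_lt_aleph0_of_forall_not_algebraicIndependent [Algebra k L] [IsScalarTower k B L]
    (htr : ∃ n : ℕ, ∀ x : Fin (n + 1) → B, ¬ AlgebraicIndependent k x) :
    Algebra.trdeg k L < Cardinal.aleph0 := by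
  obtain ⟨n, hn⟩ := htr
  have hB : Algebra.trdeg k B < Cardinal.aleph0 := by
    obtain ⟨s, hs⟩ := exists_isTranscendenceBasis k B
    rw [← hs.cardinalMk_eq_trdeg, Cardinal.mk_lt_aleph0_iff]
    by_contra hinf
    rw [not_finite_iff_infinite] at hinf
    exact hn _ (hs.1.comp (fun i : Fin (n + 1) => Infinite.natEmbedding s i)
      ((Infinite.natEmbedding s).injective.comp Fin.val_injective))
  have h := lift_trdeg_add_eq k B L
  have : Algebra.IsAlgebraic B L := IsLocalization.isAlgebraic L (nonZeroDivisors B)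
  rw [trdeg_eq_zero_iff.2 this, Cardinal.lift_zero, add_zero] at h
  rwa [← Cardinal.lift_lt_aleph0, ← h, Cardinal.lift_lt_aleph0]

theorem IsA1Star.exists_ruled [Algebra k L] [IsScalarTower k B L]
    (htr : Algebra.trdeg k L < Cardinal.aleph0) {A A' : Subring B} (hA : IsA1Star (L := L) A)
    (hA' : IsA1Star (L := L) A') (hne : A' ≠ A) :
    ∃ F : Subfield L,
      (∀ c : k, algebraMap B L (algebraMap k B c) ∈ F) ∧
      F ≤ fracField (L := L) A ∧
      ∃ t : L,
        fracField (L := L) A = Subfield.closure ((F : Set L) ∪ {t}) ∧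
        (∀ p : Polynomial ↥F, Polynomial.eval₂ F.subtype t p = 0 → p = 0) := by
  have hk : ∀ {A : Subring B}, IsA1Star (L := L) A → ∀ c : k,
      algebraMap k L c ∈ fracField (L := L) A := by
    intro A hA c
    by_cases hc : c = 0
    · rw [hc, map_zero]; exact zero_mem _
    rw [IsScalarTower.algebraMap_apply k B L]
    exact hA.mem_fracField_of_mul_eq_one (c := algebraMap k B c⁻¹)
      (by rw [← map_mul, mul_inv_cancel₀ hc, map_one])
  obtain ⟨b, hbA', hbA⟩ := SetLike.not_le_iff_exists.1 fun h => hne (hA.eq_of_le hA' h)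
  obtain ⟨t, ht, htop, hpoly⟩ := hA.exists_transcendental
  obtain ⟨t', ht', htop', -⟩ := hA'.exists_transcendental
  obtain ⟨p, hp⟩ := hpoly b
  have hbK : algebraMap B L b ∉ fracField (L := L) A := fun h => hbA
    (hA.mem_of_isAlgebraic (L := L) (isAlgebraic_algebraMap (⟨_, h⟩ : fracField (L := L) A)))
  have hbK' : algebraMap B L b ∈ fracField (L := L) A' := algebraMap_mem_fracField hbA'
  rw [← hp] at hbK hbK'
  obtain ⟨E, hkE, ρ, hρ, hgen⟩ : ∃ E : Subfield (fracField (L := L) A),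
      (∀ c : k, (⟨algebraMap k L c, hk hA c⟩ : fracField (L := L) A) ∈ E) ∧
      ∃ ρ : fracField (L := L) A, Transcendental E ρ ∧ Subfield.closure ((E : Set _) ∪ {ρ}) = ⊤ :=
    IntermediateField.exists_ruled htr ((fracField (L := L) A).toIntermediateField (hk hA))
      ((fracField (L := L) A').toIntermediateField (hk hA')) ht ht' htop htop' (p := p) hbK' hbK
  refine ⟨E.map (fracField (L := L) A).subtype, fun c => ?_, ?_, ρ, ?_, fun p hp => ?_⟩
  · rw [← IsScalarTower.algebraMap_apply k B L]
    exact ⟨_, hkE c, rfl⟩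
  · rintro _ ⟨x, -, rfl⟩
    exact x.2
  · have h := congrArg (Subfield.map (fracField (L := L) A).subtype) hgen
    rw [RingHom.map_field_closure, Set.image_union, Set.image_singleton,
      ← RingHom.fieldRange_eq_map, Subfield.fieldRange_subtype] at h
    exact h.symm
  · let σ := (fracField (L := L) A).subtype
    let i : E →+* E.map σ := (σ.comp E.subtype).codRestrict _ fun x => ⟨x, x.2, rfl⟩
    have hi : Function.Surjective i := by
      rintro ⟨_, x, hx, rfl⟩
      exact ⟨⟨x, hx⟩, rfl⟩
    obtain ⟨q, rfl⟩ := map_surjective i hi p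
    have hq : aeval ρ q = 0 := by
      refine σ.injective ?_
      rw [map_zero, ← hp, eval₂_map, aeval_def, hom_eval₂]
      rfl
    rw [(transcendental_iff.1 hρ) q hq, Polynomial.map_zero]

end Ruled

end Auxiliary

/-- If `B` is a `k`-domain of finite transcendence degree over `k` admitting two distinct
members of `𝒜₁*(B)`, then for every `A ∈ 𝒜₁*(B)` the field `Frac A` is ruled over `k`:
there is an intermediate field `k ⊆ F ⊆ Frac A` with `Frac A = F(t)` purely
transcendental of degree 1 over `F`. -/
theorem stmt11 {k B L : Type*} [Field k] [CommRing B] [IsDomain B] [Algebra k B]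
    [Field L] [Algebra B L] [IsFractionRing B L]
    (htr : ∃ n : ℕ, ∀ x : Fin (n + 1) → B, ¬ AlgebraicIndependent k x)
    (A₁ A₂ : Subring B) (h₁ : IsA1Star (L := L) A₁) (h₂ : IsA1Star (L := L) A₂)
    (hne : A₁ ≠ A₂)
    (A : Subring B) (hA : IsA1Star (L := L) A) :
    ∃ F : Subfield L,
      (∀ c : k, algebraMap B L (algebraMap k B c) ∈ F) ∧
      F ≤ fracField (L := L) A ∧
      ∃ t : L,
        fracField (L := L) A = Subfield.closure ((F : Set L) ∪ {t}) ∧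
        (∀ p : Polynomial ↥F, Polynomial.eval₂ F.subtype t p = 0 → p = 0) := by
  let : Algebra k L := ((algebraMap B L).comp (algebraMap k B)).toAlgebra
  have : IsScalarTower k B L := IsScalarTower.of_algebraMap_eq fun _ => rfl
  have htr' := trdeg_lt_aleph0_of_forall_not_algebraicIndependent (L := L) htr
  by_cases h : A₁ = A
  · exact hA.exists_ruled htr' h₂ fun h' => hne (h.trans h'.symm)
  · exact hA.exists_ruled htr' h₁ h
end

section
/- Let k be a field of characteristic zero and B a k-domain with trdeg_k(B) < ∞. If B admits two nonzero locally nilpotent derivations with distinct kernels (i.e., B is not semi-rigid), then there exists a field K with k ⊆ K ⊆ Frac(B) such that Frac(B) is a purely transcendental extension of K of transcendence degree 2. -/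
def IsLND {B : Type*} [CommRing B] (D : B → B) : Prop :=
  (∀ a b : B, D (a + b) = D a + D b) ∧
  (∀ a b : B, D (a * b) = a * D b + D a * b) ∧
  (∀ x : B, ∃ n : ℕ, D^[n] x = 0)

open Polynomial in
/-- Evaluating at `r` a polynomial with constant coefficients, a derivation obeys the chain rule. -/
theorem Derivation.map_eval_of_coeff {S R : Type*} [CommRing S] [CommRing R] [Algebra S R] (D
    : Derivation S R R) (r : R)
    (q : R[X]) (hq : ∀ i, D (q.coeff i) = 0) : D (q.eval r) = q.derivative.eval r * D r := by
  rw [Derivation.apply_eval_eq, smul_eq_mul]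
  have : D.mapCoeffs q = 0 := by
    ext i
    exact hq i
  rw [this]
  simp

open Polynomial in
/-- An element that is not a constant of `D` is transcendental over the constants of `D`. -/
theorem Derivation.eq_zero_of_eval_eq_zero {S R : Type*} [CommRing S] [CommRing R] [IsDomain R]
    [Algebra S R] [CharZero R]
    (D : Derivation S R R) {r : R} (hr : D r ≠ 0) (q : R[X]) (hq : ∀ i, D (q.coeff i) = 0)
    (h0 : q.eval r = 0) : q = 0 := by
  induction hn : q.natDegree using Nat.strong_induction_on generalizing q with
  | _ n ih =>
    have hd := D.map_eval_of_coeff r q hq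
    rw [h0, map_zero] at hd
    have hd' : q.derivative.eval r = 0 := (mul_eq_zero.1 hd.symm).resolve_right hr
    have hder : q.derivative = 0 := by
      by_cases hq0 : q.natDegree = 0
      · exact derivative_of_natDegree_zero hq0
      refine ih _ (hn ▸ natDegree_derivative_lt hq0) q.derivative (fun i => ?_) hd' rfl
      rw [coeff_derivative, D.leibniz, hq, smul_zero, add_zero, ← Nat.cast_one (R := R),
        ← Nat.cast_add, D.map_natCast, smul_zero]
    have hC := eq_C_of_natDegree_eq_zero (derivative_eq_zero.1 hder)
    rw [hC, eval_C] at h0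
    rw [hC, h0, C_0]

theorem Derivation.iterate_const_mul {S R : Type*} [CommRing S] [CommRing R] [Algebra S R] (D
    : Derivation S R R) {a : R}
    (ha : D a = 0) (n : ℕ) (x : R) : D^[n] (a * x) = a * D^[n] x := by
  induction n generalizing x with
  | zero => rfl
  | succ n ih => simp [Function.iterate_succ_apply, ha, ih]

theorem Derivation.iterate_sub {S R : Type*} [CommRing S] [CommRing R] [Algebra S R] (D
    : Derivation S R R) (n : ℕ) (x y : R) :
    D^[n] (x - y) = D^[n] x - D^[n] y := by
  induction n generalizing x y with
  | zero => rfl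
  | succ n ih => simp [Function.iterate_succ_apply, ih]

theorem Derivation.map_pow_of_const {S R : Type*} [CommRing S] [CommRing R] [Algebra S R] (D
    : Derivation S R R) {a : R}
    (ha : D a = 0) (n : ℕ) : D (a ^ n) = 0 := by
  simp [D.leibniz_pow, ha]

theorem Derivation.iterate_pow_of_map_const {S R : Type*} [CommRing S] [CommRing R] [Algebra S R]
    (D : Derivation S R R)
    {r : R} (hr : D (D r) = 0) (n : ℕ) : D^[n] (r ^ n) = n.factorial * D r ^ n := by
  induction n with
  | zero => simp
  | succ n ih =>
    have h : D (r ^ (n + 1)) = ((n + 1 : ℕ) * D r) * r ^ n := by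
      rw [D.leibniz_pow]
      simp only [nsmul_eq_mul, smul_eq_mul, Nat.add_sub_cancel]
      ring
    have hc : D ((n + 1 : ℕ) * D r) = 0 := by
      rw [D.leibniz, hr, D.map_natCast, smul_zero, smul_zero, add_zero]
    rw [Function.iterate_succ_apply, h, D.iterate_const_mul hc, ih, Nat.factorial_succ]
    push_cast
    ring

/-- If `r` is a local slice of `D`, then elements on which `D` is nilpotent are polynomials in `r`
with constant coefficients, after inverting the integers and `D r`. -/
theorem Derivation.mem_of_iterate_eq_zero {S R L : Type*} [CommRing S] [CommRing R] [Algebra S R]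
    [CommRing L]
    (D : Derivation S R R) (φ : R →+* L) (M : Subring L) {r : R} (hr : D (D r) = 0)
    (hrM : φ r ∈ M)
    (hinv : ∀ n : ℕ, ∀ x, φ (n.factorial * D r ^ n) * x ∈ M → x ∈ M)
    (P : R → Prop) (hPD : ∀ x, P x → P (D x))
    (hP : ∀ x n, P x → P (n.factorial * D r ^ n * x - D^[n] x * r ^ n))
    (hker : ∀ x, P x → D x = 0 → φ x ∈ M) (n : ℕ) (x : R) (hx : P x) (hn : D^[n] x = 0) :
    φ x ∈ M := by
  induction n generalizing x with
  | zero =>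
    rw [Function.iterate_zero_apply] at hn
    simp [hn]
  | succ n ih =>
    rw [Function.iterate_succ_apply'] at hn
    have hPn : P (D^[n] x) := by
      clear ih hn
      induction n with
      | zero => exact hx
      | succ n ih =>
        rw [Function.iterate_succ_apply']
        exact hPD _ ih
    have hc : D (n.factorial * D r ^ n) = 0 := by
      rw [D.leibniz, D.map_pow_of_const hr, D.map_natCast, smul_zero, smul_zero, add_zero]
    have hy := ih _ (hP x n hx) (by
      rw [D.iterate_sub, D.iterate_const_mul hc, D.iterate_const_mul hn,
        D.iterate_pow_of_map_const hr]
      ring)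
    refine hinv n _ ?_
    rw [map_sub, map_mul, map_mul _ (D^[n] x), map_pow] at hy
    have := M.add_mem hy (M.mul_mem (hker _ hPn hn) (M.pow_mem hrM n))
    rwa [sub_add_cancel] at this

theorem Derivation.exists_iterate_slice {S R : Type*} [CommRing S] [CommRing R] [Algebra S R] (D
    : Derivation S R R) {x : R}
    (hx : D x ≠ 0) {n : ℕ} (hn : D^[n] x = 0) :
    ∃ j, D (D^[j] x) ≠ 0 ∧ D (D (D^[j] x)) = 0 := by
  induction n generalizing x with
  | zero =>
    rw [Function.iterate_zero_apply] at hn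
    simp [hn] at hx
  | succ n ih =>
    by_cases h : D (D x) = 0
    · exact ⟨0, hx, h⟩
    · obtain ⟨j, hj⟩ := ih h hn
      exact ⟨j + 1, hj⟩

/-- The quotient rule extends a derivation to the field of fractions. -/
theorem Derivation.exists_extend {B L : Type*} [CommRing B] [IsDomain B] [Field L] [Algebra B L]
    [IsFractionRing B L] (D : Derivation ℤ B B) :
    ∃ Δ : Derivation ℤ L L, ∀ b, Δ (algebraMap B L b) = algebraMap B L (D b) := by
  have hinj : Function.Injective (algebraMap B L) := IsFractionRing.injective B L
  have hne : ∀ b : B, b ≠ 0 → algebraMap B L b ≠ 0 := fun b hb =>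
    (map_ne_zero_iff _ hinj).2 hb
  have hex : ∀ x : L, ∃ a b : B, b ≠ 0 ∧ x = algebraMap B L a / algebraMap B L b := fun x => by
    obtain ⟨a, b, hb, h⟩ := IsFractionRing.div_surjective (A := B) x
    exact ⟨a, b, nonZeroDivisors.ne_zero hb, h.symm⟩
  choose num den hden hx using hex
  let f : L → L := fun x => (algebraMap B L (den x) * algebraMap B L (D (num x)) -
    algebraMap B L (num x) * algebraMap B L (D (den x))) / algebraMap B L (den x) ^ 2
  have key : ∀ (x : L) (a b : B), b ≠ 0 → x = algebraMap B L a / algebraMap B L b →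
      f x = (algebraMap B L b * algebraMap B L (D a) -
        algebraMap B L a * algebraMap B L (D b)) / algebraMap B L b ^ 2 := by
    intro x a b hb h
    have h1 : num x * b = a * den x := by
      apply hinj
      rw [map_mul, map_mul]
      exact (div_eq_div_iff (hne _ (hden x)) (hne _ hb)).1 ((hx x).symm.trans h)
    have h2 := congrArg (algebraMap B L) (congrArg D h1)
    have h1' := congrArg (algebraMap B L) h1
    simp only [D.leibniz, smul_eq_mul, map_add, map_mul] at h2 h1'
    have hb' := hne _ hb
    have hd' := hne _ (hden x)
    rw [div_eq_div_iff (pow_ne_zero 2 hd') (pow_ne_zero 2 hb')]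
    linear_combination (algebraMap B L (den x) * algebraMap B L b) * h2 -
      (algebraMap B L b * algebraMap B L (D (den x)) +
        algebraMap B L (den x) * algebraMap B L (D b)) * h1'
  have hadd : ∀ x y, f (x + y) = f x + f y := by
    intro x y
    have hx' := hne _ (hden x)
    have hy' := hne _ (hden y)
    rw [key (x + y) (num x * den y + den x * num y) (den x * den y)
      (mul_ne_zero (hden x) (hden y)) (by
        conv_lhs => rw [hx x, hx y]
        rw [div_add_div _ _ hx' hy']
        simp)]
    simp only [f, D.leibniz, smul_eq_mul, map_add, map_mul]
    field_simp
    ring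
  have hmul : ∀ x y, f (x * y) = x • f y + y • f x := by
    intro x y
    have hx' := hne _ (hden x)
    have hy' := hne _ (hden y)
    rw [key (x * y) (num x * num y) (den x * den y)
      (mul_ne_zero (hden x) (hden y)) (by
        conv_lhs => rw [hx x, hx y]
        rw [div_mul_div_comm]
        simp)]
    have e1 : x • f y = algebraMap B L (num x) / algebraMap B L (den x) * f y := by
      rw [smul_eq_mul, ← hx x]
    have e2 : y • f x = algebraMap B L (num y) / algebraMap B L (den y) * f x := by
      rw [smul_eq_mul, ← hx y]
    rw [e1, e2]
    simp only [f, D.leibniz, smul_eq_mul, map_add, map_mul]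
    field_simp
    ring
  refine ⟨Derivation.mk' (AddMonoidHom.toIntLinearMap (AddMonoidHom.mk' f hadd)) hmul, fun b => ?_⟩
  have := key (algebraMap B L b) b 1 one_ne_zero (by simp)
  have h : f (algebraMap B L b) = algebraMap B L (D b) := by simpa using this
  exact h

open Polynomial in
theorem Derivation.exists_homogeneous {F : Type*} [Field F] (e : Derivation ℤ F F) (u : F) (N : ℕ) :
    ∃ E : Derivation ℤ F[X] F[X], ∀ m c,
      E (monomial m c) = monomial (m + N) (e c + m * u * c) := by
  let _ : Differential F := ⟨e⟩
  refine ⟨(X ^ N : F[X]) • Differential.mapCoeffs +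
    (C u * X ^ (N + 1) : F[X]) • (derivative' (R := F)).restrictScalars ℤ, fun m c => ?_⟩
  have h : (Differential.mapCoeffs (monomial m c) : F[X]) = monomial m (e c) :=
    Differential.mapCoeffs_monomial m c
  simp only [Derivation.add_apply, Derivation.smul_apply, h, Derivation.restrictScalars_apply,
    smul_eq_mul]
  have h' : derivative' (monomial m c) = derivative (monomial m c) := rfl
  rw [h', derivative_monomial, map_add, X_pow_mul_monomial, C_mul_X_pow_eq_monomial,
    monomial_mul_monomial]
  congr 1
  cases m with
  | zero => simp
  | succ m =>
    rw [show N + 1 + (m + 1 - 1) = m + 1 + N by omega]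
    congr 1
    push_cast
    ring

open Polynomial in
theorem Derivation.eq_zero_of_eval₂_monomial {F K : Type*} [Field F] [CharZero F] [Field K]
    (i : K →+* F) (E : Derivation ℤ F[X] F[X]) (hK : ∀ x, E (C (i x)) = 0) {r : F[X]}
    (hr : E r ≠ 0) {d : ℕ} {c : F} (hd : 0 < d) (hc : c ≠ 0) (hh : E (monomial d c) = 0)
    (p : MvPolynomial (Fin 2) K)
    (hp : MvPolynomial.eval₂ (C.comp i) ![r, monomial d c] p = 0) : p = 0 := by
  set ψ : MvPolynomial (Fin 1) K →+* F[X] :=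
    MvPolynomial.eval₂Hom (C.comp i) ![monomial d c] with hψ
  have hψE : ∀ q, E (ψ q) = 0 := by
    intro q
    induction q using MvPolynomial.induction_on with
    | C a => simpa [hψ] using hK a
    | add p q hp hq => rw [map_add, map_add, hp, hq, add_zero]
    | mul_X p j hp =>
      have : ψ (MvPolynomial.X j) = monomial d c := by
        rw [Subsingleton.elim j 0]
        simp [hψ]
      rw [map_mul, this, E.leibniz, hh, hp, smul_zero, smul_zero, add_zero]
  have hψinj : ∀ q, ψ q = 0 → q = 0 := by
    intro q hq
    have hcomp : (C.comp i : K →+* F[X]) = (compRingHom (monomial d c)).comp (C.comp i) := by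
      ext; simp
    have h2 : ψ = ((compRingHom (monomial d c)).comp (mapRingHom i)).comp
        (MvPolynomial.uniqueAlgEquiv K (Fin 1)).toRingEquiv.toRingHom := by
      apply MvPolynomial.ringHom_ext
      · intro x
        have : MvPolynomial.uniqueAlgEquiv K (Fin 1) (MvPolynomial.C x) = C x :=
          (MvPolynomial.uniqueAlgEquiv K (Fin 1)).commutes x
        simp [hψ, this]
      · intro j
        rw [Subsingleton.elim j 0]
        have : MvPolynomial.uniqueAlgEquiv K (Fin 1) (MvPolynomial.X 0) = X := by
          simp [MvPolynomial.uniqueAlgEquiv]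
        simp [hψ, this]
    rw [h2] at hq
    change ((MvPolynomial.uniqueAlgEquiv K (Fin 1) q).map i).comp (monomial d c) = 0 at hq
    rw [comp_eq_zero_iff] at hq
    rcases hq with hq | ⟨-, hq⟩
    · rw [Polynomial.map_eq_zero] at hq
      exact (EmbeddingLike.map_eq_zero_iff (f := MvPolynomial.uniqueAlgEquiv K (Fin 1))).1 hq
    · have := congrArg natDegree hq
      rw [natDegree_monomial_eq _ hc, natDegree_C] at this
      omega
  have hp' : ((MvPolynomial.finSuccEquiv K 1 p).map ψ).eval r = 0 := by
    rw [← hp]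
    have : ((evalRingHom r).comp (mapRingHom ψ)).comp
        (MvPolynomial.finSuccEquiv K 1).toRingEquiv.toRingHom =
        MvPolynomial.eval₂Hom (C.comp i) ![r, monomial d c] := by
      apply MvPolynomial.ringHom_ext
      · intro x
        have : MvPolynomial.finSuccEquiv K 1 (MvPolynomial.C x) = C (MvPolynomial.C x) :=
          (MvPolynomial.finSuccEquiv K 1).commutes x
        simp [this, hψ]
      · intro j
        refine Fin.cases ?_ (fun j => ?_) j
        · simp [MvPolynomial.finSuccEquiv_X_zero]
        · rw [Subsingleton.elim j 0]
          have : MvPolynomial.finSuccEquiv K 1 (MvPolynomial.X 1) = C (MvPolynomial.X 0) :=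
            MvPolynomial.finSuccEquiv_X_succ (j := (0 : Fin 1))
          simp [this, hψ]
    exact RingHom.congr_fun this p
  have h0 := E.eq_zero_of_eval_eq_zero hr _ (fun j => by rw [coeff_map]; exact hψE _) hp'
  have : MvPolynomial.finSuccEquiv K 1 p = 0 := by
    ext1 j
    have := congrArg (coeff · j) h0
    simp only [coeff_map, coeff_zero] at this
    rw [hψinj _ this, coeff_zero]
  simpa using this

open Polynomial in
theorem exists_subfield_of_homogeneous_derivation {L : Type*} [Field L] [CharZero L]
    (F : Subfield L) (ι : F[X] →+* L) (hιC : ∀ c, ι (C c) = c) (hι : Function.Injective ι)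
    (hgen : Subfield.closure (Set.range ι) = ⊤) (E : Derivation ℤ F[X] F[X]) (N : ℕ)
    (hE : ∀ m c, ∃ c', E (monomial m c) = monomial (m + N) c') (hE0 : ∃ x, E x ≠ 0)
    (h1 : ∀ c : F, ∃ a b : F, b ≠ 0 ∧ c * b = a ∧ (∃ n, E^[n] (monomial 0 a) = 0) ∧
      ∃ n, E^[n] (monomial 0 b) = 0)
    (h2 : ∃ g : F, g ≠ 0 ∧ ∃ n, E^[n] (monomial 1 g) = 0)
    (h3 : ∃ m, 0 < m ∧ ∃ c : F, c ≠ 0 ∧ E (monomial m c) = 0) :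
    ∃ K : Subfield L, (∀ c : F, E (C c) = 0 → (c : L) ∈ K) ∧
      ∃ t₁ t₂ : L,
        (∀ p : MvPolynomial (Fin 2) ↥K,
          MvPolynomial.eval₂ K.subtype ![t₁, t₂] p = 0 → p = 0) ∧
        Subfield.closure ((K : Set L) ∪ {t₁, t₂}) = (⊤ : Subfield L) := by
  classical
  have hx : ∃ m c n, E (monomial m c) ≠ 0 ∧ E^[n] (monomial m c) = 0 := by
    by_contra! hcon
    have hz : ∀ m c n, E^[n] (monomial m c) = 0 → E (monomial m c) = 0 := by
      intro m c n hn
      by_contra h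
      exact hcon m c n h hn
    have hC : ∀ c, E (C c) = 0 := by
      intro c
      obtain ⟨a, b, hb, hab, ⟨n, ha⟩, ⟨n', hb'⟩⟩ := h1 c
      have ha := hz _ _ _ ha
      have hb' := hz _ _ _ hb'
      rw [monomial_zero_left] at ha hb'
      rw [← hab, C_mul, E.leibniz, hb', smul_zero, zero_add, smul_eq_mul] at ha
      exact (mul_eq_zero.1 ha).resolve_left (C_ne_zero.2 hb)
    obtain ⟨g, hg, n, hn⟩ := h2
    have hX := hz _ _ _ hn
    rw [← C_mul_X_eq_monomial, E.leibniz, hC, smul_zero, add_zero, smul_eq_mul] at hX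
    have hX := (mul_eq_zero.1 hX).resolve_left (C_ne_zero.2 hg)
    obtain ⟨x, hx⟩ := hE0
    apply hx
    clear hx
    induction x using Polynomial.induction_on' with
    | add p q hp hq => rw [map_add, hp, hq, add_zero]
    | monomial m c =>
      rw [← C_mul_X_pow_eq_monomial, E.leibniz, hC, E.map_pow_of_const hX, smul_zero, smul_zero,
        add_zero]
  have hiter : ∀ m c n, ∃ c', E^[n] (monomial m c) = monomial (m + n * N) c' := by
    intro m c n
    induction n with
    | zero => exact ⟨c, by simp⟩
    | succ n ih =>
      obtain ⟨c', hc'⟩ := ih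
      obtain ⟨c'', hc''⟩ := hE (m + n * N) c'
      refine ⟨c'', ?_⟩
      rw [Function.iterate_succ_apply', hc', hc'', add_assoc, ← Nat.succ_mul]
  obtain ⟨r, ⟨mr, cr, hrmon⟩, hr, hr'⟩ :
      ∃ r, (∃ m c, r = monomial m c) ∧ E r ≠ 0 ∧ E (E r) = 0 := by
    obtain ⟨m, c, n, hx, hn⟩ := hx
    obtain ⟨j, hj, hj'⟩ := E.exists_iterate_slice hx hn
    obtain ⟨c', hc'⟩ := hiter m c j
    exact ⟨_, ⟨_, c', hc'⟩, hj, hj'⟩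
  obtain ⟨hd, c, hc, hh⟩ := Nat.find_spec h3
  have hmin := fun m => Nat.find_min h3 (m := m)
  set d := Nat.find h3
  let K₀ : Subfield F :=
    { carrier := {c | E (C c) = 0}
      mul_mem' := fun {a b} ha hb => by
        simp only [Set.mem_ofPred_eq] at ha hb ⊢
        rw [C_mul, E.leibniz, ha, hb, smul_zero, smul_zero, add_zero]
      one_mem' := by simp
      add_mem' := fun {a b} ha hb => by
        simp only [Set.mem_ofPred_eq] at ha hb ⊢
        rw [C_add, map_add, ha, hb, add_zero]
      zero_mem' := by simp
      neg_mem' := fun {a} ha => by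
        simp only [Set.mem_ofPred_eq] at ha ⊢
        rw [C_neg, map_neg, ha, neg_zero]
      inv_mem' := fun a ha => by
        simp only [Set.mem_ofPred_eq] at ha ⊢
        by_cases h0 : a = 0
        · simp [h0]
        have h : E (C a * C a⁻¹) = 0 := by
          rw [← C_mul, mul_inv_cancel₀ h0, C_1, E.map_one_eq_zero]
        rw [E.leibniz, ha, smul_zero, add_zero, smul_eq_mul] at h
        exact (mul_eq_zero.1 h).resolve_left (C_ne_zero.2 h0) }
  let K : Subfield L := K₀.map F.subtype
  have hKmem : ∀ c : F, E (C c) = 0 → (c : L) ∈ K := fun c hc => ⟨c, hc, rfl⟩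
  have hKF : K ≤ F := by
    rintro _ ⟨c, -, rfl⟩
    exact c.2
  refine ⟨K, hKmem, ι r, ι (monomial d c), ?_, ?_⟩
  · intro p hp
    refine E.eq_zero_of_eval₂_monomial (Subfield.inclusion hKF) ?_ hr hd hc hh p ?_
    · rintro ⟨_, x, hx, rfl⟩
      exact hx
    · apply hι
      rw [map_zero, ← hp, MvPolynomial.hom_eval₂]
      congr 1
      · ext x
        simp [hιC]
        rfl
      · ext j
        fin_cases j <;> rfl
  · set M := Subfield.closure ((K : Set L) ∪ {ι r, ι (monomial d c)}) with hM
    have hKM : ∀ x ∈ K, x ∈ M := fun x hx => Subfield.subset_closure (Or.inl hx)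
    have hrM : ι r ∈ M := Subfield.subset_closure (Or.inr (Or.inl rfl))
    have hhM : ι (monomial d c) ∈ M := Subfield.subset_closure (Or.inr (Or.inr rfl))
    have hker : ∀ m a, E (monomial m a) = 0 → ι (monomial m a) ∈ M := by
      intro m
      induction m using Nat.strong_induction_on with
      | _ m ih =>
        intro a ha
        rcases Nat.eq_zero_or_pos m with rfl | hm
        · rw [monomial_zero_left] at ha ⊢
          rw [hιC]
          exact hKM _ (hKmem a ha)
        by_cases ha0 : a = 0
        · simp [ha0]
        have hdm : d ≤ m := by
          by_contra hlt
          exact hmin m (not_le.1 hlt) ⟨hm, a, ha0, ha⟩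
        have hsplit : monomial m a = monomial (m - d) (a / c) * monomial d c := by
          rw [monomial_mul_monomial, Nat.sub_add_cancel hdm, div_mul_cancel₀ _ hc]
        rw [hsplit, E.leibniz, hh, smul_zero, zero_add, smul_eq_mul] at ha
        have hne : monomial d c ≠ 0 := by simpa using hc
        rw [hsplit, map_mul]
        exact M.mul_mem (ih _ (by omega) _ ((mul_eq_zero.1 ha).resolve_left hne)) hhM
    obtain ⟨cg, hcg⟩ := hE mr cr
    have hgM : ι (E r) ∈ M := by
      rw [hrmon, hcg]
      apply hker
      rw [← hcg, ← hrmon, hr']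
    have hmem : ∀ m a n, E^[n] (monomial m a) = 0 → ι (monomial m a) ∈ M := by
      intro m a n hn
      refine E.mem_of_iterate_eq_zero ι M.toSubring hr' hrM ?_ (fun x => ∃ m a, x = monomial m a)
        ?_ ?_ ?_ n _ ⟨m, a, rfl⟩ hn
      · intro n x hx
        have hne : ι (n.factorial * E r ^ n) ≠ 0 := by
          rw [map_ne_zero_iff _ hι]
          exact mul_ne_zero (Nat.cast_ne_zero.2 n.factorial_ne_zero) (pow_ne_zero _ hr)
        have hmem : ι (n.factorial * E r ^ n) ∈ M := by
          rw [map_mul, map_natCast, map_pow]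
          exact M.mul_mem (natCast_mem M _) (M.pow_mem hgM _)
        have := M.mul_mem (M.inv_mem hmem) hx
        rwa [inv_mul_cancel_left₀ hne] at this
      · rintro _ ⟨m, a, rfl⟩
        exact ⟨_, hE m a⟩
      · rintro _ n ⟨m, a, rfl⟩
        obtain ⟨a', ha'⟩ := hiter m a n
        rw [ha', hrmon, hcg, ← C_eq_natCast, monomial_pow, monomial_pow, C_mul_monomial,
          monomial_mul_monomial, monomial_mul_monomial,
          show m + n * N + mr * n = (mr + N) * n + m by ring, ← map_sub]
        exact ⟨_, _, rfl⟩
      · rintro _ ⟨m, a, rfl⟩ h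
        exact hker m a h
    have hF : ∀ a : F, ι (C a) ∈ M := by
      intro a
      obtain ⟨b, b', hb', hab, ⟨n, hb⟩, ⟨n', hn'⟩⟩ := h1 a
      have hb := hmem _ _ _ hb
      have hn' := hmem _ _ _ hn'
      rw [monomial_zero_left, hιC] at hb hn'
      rw [hιC, show (a : L) = b / b' by
        rw [← hab]; push_cast; rw [mul_div_cancel_right₀ _ (by simpa using hb')]]
      exact M.div_mem hb hn'
    have hX : ι X ∈ M := by
      obtain ⟨g, hg, n, hn⟩ := h2
      have h := hmem _ _ _ hn
      rw [← C_mul_X_eq_monomial, map_mul] at h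
      have := M.mul_mem (M.inv_mem (hF g)) h
      rwa [inv_mul_cancel_left₀ (by rw [hιC]; simpa using hg)] at this
    rw [eq_top_iff, ← hgen, Subfield.closure_le]
    rintro _ ⟨p, rfl⟩
    induction p using Polynomial.induction_on' with
    | add p q hp hq => rw [map_add]; exact M.add_mem hp hq
    | monomial n a =>
      rw [← C_mul_X_pow_eq_monomial, map_mul, map_pow]
      exact M.mul_mem (hF a) (M.pow_mem hX n)

open Polynomial in
/-- The derivation of `F` induced by the `n`-th coefficient of a derivation of `F[X]`. -/
noncomputable def Derivation.coeffConst {F : Type*} [Field F] (δ : Derivation ℤ F[X] F[X]) (n : ℕ) :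
    Derivation ℤ F F :=
  Derivation.mk' (AddMonoidHom.toIntLinearMap
    (AddMonoidHom.mk' (fun c => (δ (C c)).coeff n) fun a b => by simp)) fun a b => by
      simp

open Polynomial in
theorem Derivation.coeffConst_apply {F : Type*} [Field F] (δ : Derivation ℤ F[X] F[X]) (n : ℕ)
    (c : F) : δ.coeffConst n c = (δ (C c)).coeff n := rfl

open Polynomial in
theorem Derivation.map_leading {F : Type*} [Field F] (δ E : Derivation ℤ F[X] F[X]) (N : ℕ)
    (hC : ∀ c, (δ (C c)).natDegree ≤ N) (hX : (δ X).natDegree ≤ N + 1)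
    (hE : ∀ m c, E (monomial m c) =
      monomial (m + N) ((δ (C c)).coeff N + m * (δ X).coeff (N + 1) * c))
    (m : ℕ) (p : F[X]) (hp : p.natDegree ≤ m) :
    (δ p).natDegree ≤ m + N ∧
      E (monomial m (p.coeff m)) = monomial (m + N) ((δ p).coeff (m + N)) := by
  have hmono : ∀ i c, i ≤ m → (δ (monomial i c)).natDegree ≤ m + N ∧
      E (monomial m ((monomial i c).coeff m)) =
        monomial (m + N) ((δ (monomial i c)).coeff (m + N)) := by
    intro i c hi
    have hδ : δ (monomial i c) = C (c * i) * (X ^ (i - 1) * δ X) + X ^ i * δ (C c) := by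
      rw [← C_mul_X_pow_eq_monomial, δ.leibniz, δ.leibniz_pow]
      simp only [smul_eq_mul, nsmul_eq_mul, C_mul, C_eq_natCast]
      ring
    have h2 : (X ^ i * δ (C c)).natDegree ≤ i + N := by
      refine natDegree_mul_le.trans ?_
      rw [natDegree_X_pow]
      exact Nat.add_le_add_left (hC c) i
    have h1 : (C (c * i) * (X ^ (i - 1) * δ X)).natDegree ≤ i + N := by
      rcases Nat.eq_zero_or_pos i with rfl | hi0
      · simp
      refine (natDegree_C_mul_le _ _).trans (natDegree_mul_le.trans ?_)
      rw [natDegree_X_pow]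
      omega
    have hdeg : (δ (monomial i c)).natDegree ≤ i + N := by
      rw [hδ]
      exact natDegree_add_le_of_degree_le h1 h2
    refine ⟨hdeg.trans (by omega), ?_⟩
    rcases hi.lt_or_eq with hlt | rfl
    · rw [coeff_eq_zero_of_natDegree_lt (show (δ (monomial i c)).natDegree < m + N by omega),
        coeff_monomial_of_ne _ (by omega)]
      simp
    · rw [coeff_monomial_same, hE, hδ, coeff_add, coeff_C_mul, add_comm i N, coeff_X_pow_mul]
      congr 1
      rw [add_comm]
      congr 1
      cases i with
      | zero => simp
      | succ i =>
        rw [Nat.add_sub_cancel, show N + (i + 1) = N + 1 + i by ring, coeff_X_pow_mul]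
        ring
  rw [p.as_sum_range' (m + 1) (by omega)]
  refine Finset.sum_induction _ (fun q => (δ q).natDegree ≤ m + N ∧
      E (monomial m (q.coeff m)) = monomial (m + N) ((δ q).coeff (m + N))) ?_ ?_ ?_
  · rintro a b ⟨ha, ha'⟩ ⟨hb, hb'⟩
    refine ⟨?_, ?_⟩
    · rw [map_add]
      exact natDegree_add_le_of_degree_le ha hb
    · rw [coeff_add, map_add, map_add, ha', hb', map_add, coeff_add, map_add]
  · simp
  · intro i hi
    exact hmono i _ (by simpa [Nat.lt_succ_iff] using hi)

open Polynomial in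
theorem exists_subfield_of_derivation {L : Type*} [Field L] [CharZero L]
    (F : Subfield L) (ι : F[X] →+* L) (hιC : ∀ c, ι (C c) = c) (hι : Function.Injective ι)
    (hgen : Subfield.closure (Set.range ι) = ⊤) (δ : Derivation ℤ F[X] F[X])
    (hbdd : ∃ M, ∀ c, (δ (C c)).natDegree ≤ M) (hne : ∃ c, δ (C c) ≠ 0)
    (h1 : ∀ c : F, ∃ a b : F, b ≠ 0 ∧ c * b = a ∧ (∃ n, δ^[n] (C a) = 0) ∧
      ∃ n, δ^[n] (C b) = 0)
    (h2 : ∃ g : F, g ≠ 0 ∧ ∃ n, δ^[n] (monomial 1 g) = 0)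
    (h3 : ∃ p, 0 < p.natDegree ∧ δ p = 0) :
    ∃ K : Subfield L, (∀ c : F, δ (C c) = 0 → (c : L) ∈ K) ∧
      ∃ t₁ t₂ : L,
        (∀ p : MvPolynomial (Fin 2) ↥K,
          MvPolynomial.eval₂ K.subtype ![t₁, t₂] p = 0 → p = 0) ∧
        Subfield.closure ((K : Set L) ∪ {t₁, t₂}) = (⊤ : Subfield L) := by
  let S : Set ℕ := {n | (∃ c, (δ (C c)).coeff n ≠ 0) ∨ (δ X).coeff (n + 1) ≠ 0}
  have hS : S.Nonempty := by
    obtain ⟨c, hc⟩ := hne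
    exact ⟨_, Or.inl ⟨c, leadingCoeff_ne_zero.2 hc⟩⟩
  have hSb : BddAbove S := by
    obtain ⟨M, hM⟩ := hbdd
    refine ⟨max M (δ X).natDegree, ?_⟩
    rintro n (⟨c, hc⟩ | hn)
    · exact le_max_of_le_left ((le_natDegree_of_ne_zero hc).trans (hM c))
    · exact le_max_of_le_right ((Nat.le_succ n).trans (le_natDegree_of_ne_zero hn))
  obtain ⟨N, hNS, hN⟩ : ∃ N, N ∈ S ∧ ∀ n ∈ S, n ≤ N :=
    ⟨sSup S, Nat.sSup_mem hS hSb, fun n hn => le_csSup hSb hn⟩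
  have hNC : ∀ c, (δ (C c)).natDegree ≤ N := by
    intro c
    by_cases h : δ (C c) = 0
    · simp [h]
    · exact hN _ (Or.inl ⟨c, leadingCoeff_ne_zero.2 h⟩)
  have hNX : (δ X).natDegree ≤ N + 1 := by
    rw [natDegree_le_iff_coeff_eq_zero]
    intro n hn
    obtain ⟨n, rfl⟩ := Nat.exists_eq_succ_of_ne_zero (Nat.ne_zero_of_lt hn)
    by_contra h
    have := hN n (Or.inr h)
    omega
  obtain ⟨E, hE⟩ := Derivation.exists_homogeneous (δ.coeffConst N) ((δ X).coeff (N + 1)) N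
  simp only [Derivation.coeffConst_apply] at hE
  have hlead := δ.map_leading E N hNC hNX hE
  have hnil : ∀ n m p, p.natDegree ≤ m → δ^[n] p = 0 → E^[n] (monomial m (p.coeff m)) = 0 := by
    intro n
    induction n with
    | zero =>
      intro m p _ h
      rw [Function.iterate_zero_apply] at h
      simp [h]
    | succ n ih =>
      intro m p hp h
      obtain ⟨h1, h2⟩ := hlead m p hp
      rw [Function.iterate_succ_apply, h2]
      exact ih _ _ h1 h
  have hnilC : ∀ a, (∃ n, δ^[n] (C a) = 0) → ∃ n, E^[n] (monomial 0 a) = 0 := by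
    rintro a ⟨n, hn⟩
    exact ⟨n, by simpa using hnil n 0 (C a) (by simp) hn⟩
  have hE0 : ∃ x, E x ≠ 0 := by
    rcases hNS with ⟨c, hc⟩ | hN'
    · refine ⟨monomial 0 c, ?_⟩
      rw [hE]
      simpa using hc
    · refine ⟨monomial 1 1, ?_⟩
      rw [hE, C_1, δ.map_one_eq_zero]
      simpa using hN'
  obtain ⟨K, hK, h⟩ := exists_subfield_of_homogeneous_derivation F ι hιC hι hgen E N
    (fun m c => ⟨_, hE m c⟩) hE0
    (fun c => by
      obtain ⟨a, b, hb, hab, ha, hb'⟩ := h1 c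
      exact ⟨a, b, hb, hab, hnilC a ha, hnilC b hb'⟩)
    (by
      obtain ⟨g, hg, n, hn⟩ := h2
      exact ⟨g, hg, n, by simpa using hnil n 1 _ (natDegree_monomial_le _) hn⟩)
    (by
      obtain ⟨p, hp, hδ⟩ := h3
      refine ⟨p.natDegree, hp, p.leadingCoeff, ?_, hnil 1 _ p le_rfl hδ⟩
      exact leadingCoeff_ne_zero.2 (ne_zero_of_natDegree_gt hp))
  refine ⟨K, fun c hc => hK c ?_, h⟩
  rw [← monomial_zero_left, hE, hc]
  simp

open Polynomial in
/-- A derivation of `F[X]` has bounded degree on `F` if `F` has finite transcendence degree over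
constants of the derivation. -/
theorem Derivation.exists_natDegree_le {k A F : Type*} [Field k] [CommRing A] [Nontrivial A]
    [Algebra k A] [Field F] [CharZero F] (j : A →+* F) (hj : Function.Injective j)
    (hF : ∀ c : F, ∃ a b : A, j b ≠ 0 ∧ c * j b = j a)
    (htr : ∃ n : ℕ, ∀ x : Fin (n + 1) → A, ¬ AlgebraicIndependent k x)
    (δ : Derivation ℤ F[X] F[X]) (hk : ∀ c : k, δ (C (j (algebraMap k A c))) = 0) :
    ∃ M, ∀ c, (δ (C c)).natDegree ≤ M := by
  obtain ⟨T, hT⟩ := exists_isTranscendenceBasis k A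
  have hTfin : Finite T := by
    by_contra hinf
    rw [not_finite_iff_infinite] at hinf
    obtain ⟨n, hn⟩ := htr
    let f : Fin (n + 1) ↪ T := Fin.valEmbedding.trans (Infinite.natEmbedding T)
    exact hn _ (hT.1.comp f f.injective)
  obtain ⟨M, hM⟩ := (Set.finite_range fun t : T => (δ (C (j t))).natDegree).bddAbove
  refine ⟨M, fun c => ?_⟩
  rw [natDegree_le_iff_coeff_eq_zero]
  intro n hn
  have hadj : ∀ x ∈ Algebra.adjoin k T, δ.coeffConst n (j x) = 0 := by
    intro x hx
    induction hx using Algebra.adjoin_induction with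
    | mem x hx =>
      rw [Derivation.coeffConst_apply]
      exact coeff_eq_zero_of_natDegree_lt ((hM ⟨⟨x, hx⟩, rfl⟩).trans_lt hn)
    | algebraMap r => rw [Derivation.coeffConst_apply, hk, coeff_zero]
    | add x y _ _ hx hy => rw [map_add, map_add, hx, hy, add_zero]
    | mul x y _ _ hx hy =>
      rw [map_mul, Derivation.leibniz, hx, hy, smul_zero, smul_zero, add_zero]
  have hA : ∀ a, δ.coeffConst n (j a) = 0 := by
    intro a
    by_contra hne
    have halg := hT.isAlgebraic.isAlgebraic a
    rw [Subtype.range_coe_subtype, Set.ofPred_mem_eq] at halg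
    obtain ⟨q, hq, hqa⟩ := halg
    let φ : Algebra.adjoin k T →+* F := j.comp (Algebra.adjoin k T).val.toRingHom
    have hφ : Function.Injective φ := hj.comp Subtype.val_injective
    have := (δ.coeffConst n).eq_zero_of_eval_eq_zero hne (q.map φ)
      (fun i => by rw [coeff_map]; exact hadj _ (q.coeff i).2) (by
        rw [eval_map, ← map_zero j, ← hqa, aeval_def, hom_eval₂]
        rfl)
    exact hq ((Polynomial.map_eq_zero_iff hφ).1 this)
  obtain ⟨a, b, hb, hab⟩ := hF c
  have h := hA a
  rw [← hab, Derivation.leibniz, hA b, smul_zero, zero_add, smul_eq_mul] at h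
  exact (mul_eq_zero.1 h).resolve_left hb

open Polynomial in
theorem Derivation.exists_restrict {F L : Type*} [Field F] [Field L] (ι : F[X] →+* L)
    (hι : Function.Injective ι) (Δ : Derivation ℤ L L) (h : ∀ p, ∃ q, ι q = Δ (ι p)) :
    ∃ δ : Derivation ℤ F[X] F[X], ∀ p, ι (δ p) = Δ (ι p) := by
  choose f hf using h
  exact ⟨Derivation.mk' (AddMonoidHom.toIntLinearMap (AddMonoidHom.mk' f fun a b => hι (by
    simp [hf]))) fun a b => hι (by
      simp only [AddMonoidHom.coe_toIntLinearMap, AddMonoidHom.mk'_apply, smul_eq_mul, map_add,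
        map_mul, hf, Δ.leibniz]), hf⟩

/-- The subfield of `L` generated by the kernel of a derivation of `B`. -/
def Derivation.constField {B : Type*} (L : Type*) [CommRing B] [Field L] [Algebra B L]
    (D : Derivation ℤ B B) : Subfield L :=
  Subfield.closure (algebraMap B L '' {b | D b = 0})

theorem Derivation.algebraMap_mem_constField {B L : Type*} [CommRing B] [Field L] [Algebra B L]
    (D : Derivation ℤ B B) {b : B} (hb : D b = 0) : algebraMap B L b ∈ D.constField L :=
  Subfield.subset_closure ⟨b, hb, rfl⟩

theorem Derivation.exists_div_of_mem_constField {B L : Type*} [CommRing B] [Field L] [Algebra B L]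
    (D : Derivation ℤ B B) {x : L} (hx : x ∈ D.constField L) :
    ∃ a b : B, D a = 0 ∧ D b = 0 ∧ algebraMap B L b ≠ 0 ∧
      x = algebraMap B L a / algebraMap B L b := by
  have hsub : ∀ y ∈ Subring.closure (algebraMap B L '' {b | D b = 0}),
      ∃ a, D a = 0 ∧ algebraMap B L a = y := by
    intro y hy
    induction hy using Subring.closure_induction with
    | mem y hy => exact hy
    | zero => exact ⟨0, by simp⟩
    | one => exact ⟨1, by simp⟩
    | add _ _ _ _ hx hy =>
      obtain ⟨⟨a, ha, rfl⟩, ⟨b, hb, rfl⟩⟩ := And.intro hx hy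
      exact ⟨a + b, by simp [ha, hb]⟩
    | neg _ _ hx =>
      obtain ⟨a, ha, rfl⟩ := hx
      exact ⟨-a, by simp [ha]⟩
    | mul _ _ _ _ hx hy =>
      obtain ⟨⟨a, ha, rfl⟩, ⟨b, hb, rfl⟩⟩ := And.intro hx hy
      exact ⟨a * b, by simp [ha, hb]⟩
  obtain ⟨y, hy, z, hz, rfl⟩ := Subfield.mem_closure_iff.1 hx
  obtain ⟨a, ha, rfl⟩ := hsub y hy
  obtain ⟨b, hb, rfl⟩ := hsub z hz
  by_cases h0 : algebraMap B L b = 0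
  · exact ⟨0, 1, by simp [h0]⟩
  · exact ⟨a, b, ha, hb, h0, rfl⟩

theorem Derivation.map_of_mem_constField {B L : Type*} [CommRing B] [Field L] [Algebra B L]
    (D : Derivation ℤ B B) (Δ : Derivation ℤ L L)
    (hΔ : ∀ b, D b = 0 → Δ (algebraMap B L b) = 0) {x : L} (hx : x ∈ D.constField L) :
    Δ x = 0 := by
  obtain ⟨a, b, ha, hb, -, rfl⟩ := D.exists_div_of_mem_constField hx
  rw [Δ.leibniz_div, hΔ a ha, hΔ b hb]
  simp

open Polynomial in
/-- A nonzero locally nilpotent derivation of `B` realises `B` inside a polynomial ring in one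
variable over the field of fractions of its kernel. -/
theorem Derivation.exists_polynomial_of_locallyNilpotent {B L : Type*} [CommRing B] [IsDomain B]
    [Field L] [CharZero L] [Algebra B L] [IsFractionRing B L] (D : Derivation ℤ B B)
    (hnil : ∀ x, ∃ n, D^[n] x = 0) (hD : ∃ x, D x ≠ 0) :
    ∃ (r : B) (ι : (D.constField L)[X] →+* L), D r ≠ 0 ∧ D (D r) = 0 ∧ (∀ c, ι (C c) = c) ∧
      ι X = algebraMap B L r / algebraMap B L (D r) ∧ Function.Injective ι ∧
      (∀ b, algebraMap B L b ∈ ι.range) ∧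
      ∀ p b, ι p = algebraMap B L b → p.natDegree = 0 → D b = 0 := by
  have hinj : Function.Injective (algebraMap B L) := IsFractionRing.injective B L
  obtain ⟨Δ, hΔ⟩ := D.exists_extend (L := L)
  have hΔF : ∀ x ∈ D.constField L, Δ x = 0 := fun x hx =>
    D.map_of_mem_constField Δ (fun b hb => by rw [hΔ, hb, map_zero]) hx
  obtain ⟨x, hx⟩ := hD
  obtain ⟨n, hn⟩ := hnil x
  obtain ⟨j, hr, hr'⟩ := D.exists_iterate_slice hx hn
  set r := D^[j] x
  have hg : algebraMap B L (D r) ≠ 0 := (map_ne_zero_iff _ hinj).2 hr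
  set s : L := algebraMap B L r / algebraMap B L (D r) with hs
  have hΔs : Δ s = 1 := by
    rw [hs, Δ.leibniz_div_const _ _ (by rw [hΔ, hr', map_zero]), hΔ, smul_eq_mul,
      inv_mul_cancel₀ hg]
  let ι : (D.constField L)[X] →+* L := eval₂RingHom (D.constField L).subtype s
  have hιC : ∀ c, ι (C c) = c := fun c => by simp [ι]
  have hιX : ι X = s := by simp [ι]
  have hι : Function.Injective ι := by
    rw [injective_iff_map_eq_zero]
    intro p hp
    have := Δ.eq_zero_of_eval_eq_zero (r := s) (by rw [hΔs]; exact one_ne_zero)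
      (p.map (D.constField L).subtype)
      (fun i => by rw [coeff_map]; exact hΔF _ (p.coeff i).2) (by rw [eval_map]; exact hp)
    exact (Polynomial.map_eq_zero _).1 this
  have hFι : ∀ c ∈ D.constField L, c ∈ ι.range := fun c hc => ⟨C ⟨c, hc⟩, hιC _⟩
  refine ⟨r, ι, hr, hr', hιC, hιX, hι, fun b => ?_, ?_⟩
  · obtain ⟨n, hn⟩ := hnil b
    refine D.mem_of_iterate_eq_zero (algebraMap B L) ι.range hr' ?_ ?_ (fun _ => True)
      (fun _ _ => trivial) (fun _ _ _ => trivial) ?_ n b trivial hn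
    · rw [show algebraMap B L r = algebraMap B L (D r) * s by rw [hs, mul_div_cancel₀ _ hg]]
      exact ι.range.mul_mem (hFι _ (D.algebraMap_mem_constField hr')) ⟨X, hιX⟩
    · intro n y hy
      have h0 : algebraMap B L (n.factorial * D r ^ n) ≠ 0 := by
        rw [map_mul, _root_.map_natCast, map_pow]
        exact mul_ne_zero (Nat.cast_ne_zero.2 n.factorial_ne_zero) (pow_ne_zero _ hg)
      have hmem : algebraMap B L (n.factorial * D r ^ n) ∈ D.constField L := by
        apply D.algebraMap_mem_constField
        rw [D.leibniz, D.map_natCast, D.map_pow_of_const hr', smul_zero, smul_zero, add_zero]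
      have := ι.range.mul_mem (hFι _ ((D.constField L).inv_mem hmem)) hy
      rwa [inv_mul_cancel_left₀ h0] at this
    · intro y _ hy
      exact hFι _ (D.algebraMap_mem_constField hy)
  · intro p b hp hdeg
    apply hinj
    rw [← hΔ, ← hp, eq_C_of_natDegree_eq_zero hdeg, hιC, map_zero]
    exact hΔF _ (p.coeff 0).2

open Polynomial in
/-- Locally nilpotent derivations of domains of characteristic zero vanish on units. -/
theorem Derivation.map_unit_of_locallyNilpotent {B : Type*} [CommRing B] [IsDomain B] [CharZero B]
    (D : Derivation ℤ B B) (hnil : ∀ x, ∃ n, D^[n] x = 0) {b : B} (hb : IsUnit b) : D b = 0 := by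
  by_cases hD : ∃ x, D x ≠ 0
  · have hinj := IsFractionRing.injective B (FractionRing B)
    have : CharZero (FractionRing B) := charZero_of_injective_algebraMap hinj
    obtain ⟨r, ι, -, -, -, -, hι, hB, hdeg⟩ :=
      D.exists_polynomial_of_locallyNilpotent (L := FractionRing B) hnil hD
    obtain ⟨c, hc⟩ := hb.exists_right_inv
    obtain ⟨p, hp⟩ := hB b
    obtain ⟨q, hq⟩ := hB c
    have hpq : p * q = 1 := hι (by rw [map_mul, hp, hq, ← map_mul, hc, map_one, map_one])
    exact hdeg p b hp (natDegree_eq_zero_of_isUnit (IsUnit.of_mul_eq_one q hpq))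
  · push Not at hD
    exact hD b

open Polynomial in
theorem Derivation.map_eq_zero_of_ker_le {B : Type*} (L : Type*) [CommRing B] [IsDomain B]
    [Field L] [CharZero L] [Algebra B L] [IsFractionRing B L]
    (D₁ D₂ : Derivation ℤ B B) (hnil : ∀ x, ∃ n, D₁^[n] x = 0) (hD₁ : ∃ x, D₁ x ≠ 0)
    (hD₂ : ∃ x, D₂ x ≠ 0) (hle : ∀ b, D₁ b = 0 → D₂ b = 0) {b : B} (hb : D₂ b = 0) :
    D₁ b = 0 := by
  have hinj := IsFractionRing.injective B L
  obtain ⟨r, ι, -, -, hιC, -, hι, hB, hdeg⟩ :=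
    D₁.exists_polynomial_of_locallyNilpotent (L := L) hnil hD₁
  obtain ⟨Δ, hΔ⟩ := D₂.exists_extend (L := L)
  have hΔF : ∀ x ∈ D₁.constField L, Δ x = 0 := fun x hx =>
    D₁.map_of_mem_constField Δ (fun b hb => by rw [hΔ, hle b hb, map_zero]) hx
  have hιe : ∀ p, ι p = (p.map (D₁.constField L).subtype).eval (ι X) := by
    intro p
    rw [eval_map]
    conv_lhs => rw [← eval₂_C_X (p := p), hom_eval₂]
    congr 1
    ext c
    simp [hιC]
  have hΔι : ∀ p, Δ (ι p) = ι (derivative p) * Δ (ι X) := by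
    intro p
    rw [hιe p, hιe (derivative p), Δ.map_eval_of_coeff _ _
      (fun i => by rw [coeff_map]; exact hΔF _ (p.coeff i).2), derivative_map]
  obtain ⟨p, hp⟩ := hB b
  apply hdeg p b hp
  have h := hΔι p
  rw [hp, hΔ, hb, map_zero] at h
  rcases mul_eq_zero.1 h.symm with h | h
  · exact derivative_eq_zero.1 (hι (by rw [h, map_zero]))
  · obtain ⟨x, hx⟩ := hD₂
    obtain ⟨q, hq⟩ := hB x
    refine absurd (hinj ?_) hx
    rw [← hΔ, ← hq, hΔι, h, mul_zero, map_zero]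

open Polynomial in
theorem Derivation.exists_subfield_of_locallyNilpotent {k B L : Type*} [Field k] [CharZero k]
    [CommRing B] [IsDomain B] [Algebra k B] [Field L] [Algebra B L] [IsFractionRing B L]
    (htr : ∃ n : ℕ, ∀ x : Fin (n + 1) → B, ¬ AlgebraicIndependent k x)
    (D₁ D₂ : Derivation ℤ B B) (h₁ : ∀ x, ∃ n, D₁^[n] x = 0) (h₂ : ∀ x, ∃ n, D₂^[n] x = 0)
    (h₁₂ : ∃ b, D₁ b = 0 ∧ D₂ b ≠ 0) (h₂₁ : ∃ b, D₂ b = 0 ∧ D₁ b ≠ 0) :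
    ∃ K : Subfield L,
      (∀ c : k, algebraMap B L (algebraMap k B c) ∈ K) ∧
      ∃ t₁ t₂ : L,
        (∀ p : MvPolynomial (Fin 2) ↥K,
          MvPolynomial.eval₂ K.subtype ![t₁, t₂] p = 0 → p = 0) ∧
        Subfield.closure ((K : Set L) ∪ {t₁, t₂}) = (⊤ : Subfield L) := by
  have hinj : Function.Injective (algebraMap B L) := IsFractionRing.injective B L
  have : CharZero B := charZero_of_injective_algebraMap (algebraMap k B).injective
  have : CharZero L := charZero_of_injective_algebraMap hinj
  have hk : ∀ c : k, D₁ (algebraMap k B c) = 0 ∧ D₂ (algebraMap k B c) = 0 := by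
    intro c
    by_cases hc : c = 0
    · simp [hc]
    · have hu := (Ne.isUnit hc).map (algebraMap k B)
      exact ⟨D₁.map_unit_of_locallyNilpotent h₁ hu, D₂.map_unit_of_locallyNilpotent h₂ hu⟩
  obtain ⟨b₂, hb₂, hb₂'⟩ := h₂₁
  obtain ⟨r, ι, hr, hr', hιC, hιX, hι, hB, hdeg⟩ :=
    D₁.exists_polynomial_of_locallyNilpotent (L := L) h₁ ⟨b₂, hb₂'⟩
  obtain ⟨Δ, hΔ⟩ := D₂.exists_extend (L := L)
  have hg : algebraMap B L (D₁ r) ≠ 0 := (map_ne_zero_iff _ hinj).2 hr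
  have hFι : ∀ c ∈ D₁.constField L, c ∈ ι.range := fun c hc => ⟨C ⟨c, hc⟩, hιC _⟩
  have hdiv : ∀ a b, D₁ b = 0 → Δ (algebraMap B L a / algebraMap B L b) ∈ ι.range := by
    intro a b hb
    rw [Δ.leibniz_div, hΔ, hΔ]
    simp only [smul_eq_mul, ← map_mul, ← map_sub]
    exact ι.range.mul_mem (hFι _ (pow_mem (inv_mem (D₁.algebraMap_mem_constField hb)) 2)) (hB _)
  have hΔC : ∀ c, Δ (ι (C c)) ∈ ι.range := by
    intro c
    obtain ⟨a, b, -, hb, -, hc⟩ := D₁.exists_div_of_mem_constField c.2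
    rw [hιC, hc]
    exact hdiv a b hb
  have hΔι : ∀ p, Δ (ι p) ∈ ι.range := by
    intro p
    induction p using Polynomial.induction_on with
    | C a => exact hΔC a
    | add p q hp hq =>
      rw [map_add, map_add]
      exact ι.range.add_mem hp hq
    | monomial n a h =>
      rw [pow_succ, ← mul_assoc, map_mul, Δ.leibniz]
      refine ι.range.add_mem (ι.range.mul_mem ⟨_, rfl⟩ ?_) (ι.range.mul_mem ⟨_, rfl⟩ h)
      rw [hιX]
      exact hdiv r (D₁ r) hr'
  obtain ⟨δ, hδ⟩ := Derivation.exists_restrict ι hι Δ hΔι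
  have hδB : ∀ b p, ι p = algebraMap B L b → ∀ n, ι (δ^[n] p) = algebraMap B L (D₂^[n] b) := by
    intro b p hp n
    induction n with
    | zero => exact hp
    | succ n ih => rw [Function.iterate_succ_apply', Function.iterate_succ_apply', hδ, ih, hΔ]
  have hδnil : ∀ b p, ι p = algebraMap B L b → ∃ n, δ^[n] p = 0 := by
    intro b p hp
    obtain ⟨n, hn⟩ := h₂ b
    exact ⟨n, hι (by rw [hδB b p hp, hn, map_zero, map_zero])⟩
  let A : Subalgebra k B :=
    { carrier := {b | D₁ b = 0}
      mul_mem' := fun {a b} ha hb => by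
        simp only [Set.mem_ofPred_eq] at ha hb ⊢
        simp [ha, hb]
      add_mem' := fun {a b} ha hb => by
        simp only [Set.mem_ofPred_eq] at ha hb ⊢
        simp [ha, hb]
      algebraMap_mem' := fun c => (hk c).1 }
  let j : A →+* D₁.constField L :=
    ((algebraMap B L).comp A.val.toRingHom).codRestrict _
      fun a => D₁.algebraMap_mem_constField a.2
  have hj : Function.Injective j := by
    intro a b hab
    exact Subtype.ext (hinj (congrArg Subtype.val hab))
  have hfrac : ∀ c : D₁.constField L, ∃ a b : A, j b ≠ 0 ∧ c * j b = j a := by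
    intro c
    obtain ⟨a, b, ha, hb, hb0, hc⟩ := D₁.exists_div_of_mem_constField c.2
    refine ⟨⟨a, ha⟩, ⟨b, hb⟩, fun h => hb0 (congrArg Subtype.val h), Subtype.ext ?_⟩
    change (c : L) * algebraMap B L b = algebraMap B L a
    rw [hc, div_mul_cancel₀ _ hb0]
  have hιj : ∀ a : A, ι (C (j a)) = algebraMap B L a := fun a => hιC _
  have hδC : ∀ a : A, D₂ a = 0 → δ (C (j a)) = 0 := fun a ha =>
    hι (by rw [hδ, hιj, hΔ, ha, map_zero, map_zero])
  have hgen : Subfield.closure (Set.range ι) = ⊤ := by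
    refine eq_top_iff.2 fun x _ => ?_
    obtain ⟨a, b, -, rfl⟩ := IsFractionRing.div_surjective (A := B) x
    exact div_mem (Subfield.subset_closure (hB a)) (Subfield.subset_closure (hB b))
  have hbdd := Derivation.exists_natDegree_le (k := k) j hj hfrac
    (htr.imp fun n hn x hx => hn _ (hx.map' (f := A.val) Subtype.val_injective)) δ
    (fun c => hδC _ (hk c).2)
  have hne : ∃ c, δ (C c) ≠ 0 := by
    obtain ⟨b, hb, hb'⟩ := h₁₂
    refine ⟨j ⟨b, hb⟩, fun h => hb' (hinj ?_)⟩
    have := hδ (C (j ⟨b, hb⟩))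
    rw [h, hιj, hΔ] at this
    rw [← this, map_zero, map_zero]
  have h1 : ∀ c : D₁.constField L, ∃ a b : D₁.constField L, b ≠ 0 ∧ c * b = a ∧
      (∃ n, δ^[n] (C a) = 0) ∧ ∃ n, δ^[n] (C b) = 0 := by
    intro c
    obtain ⟨a, b, hb, hab⟩ := hfrac c
    exact ⟨j a, j b, hb, hab, hδnil _ _ (hιj a), hδnil _ _ (hιj b)⟩
  have h2 : ∃ g : D₁.constField L, g ≠ 0 ∧ ∃ n, δ^[n] (monomial 1 g) = 0 := by
    refine ⟨j ⟨D₁ r, hr'⟩, fun h => hg (congrArg Subtype.val h), hδnil r _ ?_⟩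
    rw [← C_mul_X_eq_monomial, map_mul, hιj, hιX]
    exact mul_div_cancel₀ _ hg
  have h3 : ∃ p, 0 < p.natDegree ∧ δ p = 0 := by
    obtain ⟨p, hp⟩ := hB b₂
    refine ⟨p, Nat.pos_of_ne_zero fun h => hb₂' (hdeg p b₂ hp h), hι ?_⟩
    rw [hδ, hp, hΔ, hb₂, map_zero, map_zero]
  obtain ⟨K, hK, h⟩ :=
    exists_subfield_of_derivation (D₁.constField L) ι hιC hι hgen δ hbdd hne h1 h2 h3
  exact ⟨K, fun c => hK (j (algebraMap k A c)) (hδC _ (hk c).2), h⟩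

theorem IsLND.exists_derivation {B : Type*} [CommRing B] {D : B → B} (h : IsLND D) :
    ∃ Δ : Derivation ℤ B B, ⇑Δ = D :=
  ⟨Derivation.mk' (AddMonoidHom.toIntLinearMap (AddMonoidHom.mk' D h.1)) fun a b => by
    simp only [AddMonoidHom.coe_toIntLinearMap, AddMonoidHom.mk'_apply, smul_eq_mul, h.2.1,
      mul_comm b], rfl⟩

/-- If `B` is a `k`-domain (`k` of characteristic zero) of finite transcendence degree
over `k` which is not semi-rigid (it has two nonzero locally nilpotent derivations with
distinct kernels), then there is a field `K` with `k ⊆ K ⊆ Frac B` such that `Frac B`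
is purely transcendental of transcendence degree 2 over `K`. -/
theorem stmt12 {k B L : Type*} [Field k] [CharZero k] [CommRing B] [IsDomain B]
    [Algebra k B] [Field L] [Algebra B L] [IsFractionRing B L]
    (htr : ∃ n : ℕ, ∀ x : Fin (n + 1) → B, ¬ AlgebraicIndependent k x)
    (D₁ D₂ : B → B) (h₁ : IsLND D₁) (h₂ : IsLND D₂) (h₁0 : D₁ ≠ 0) (h₂0 : D₂ ≠ 0)
    (hker : {x : B | D₁ x = 0} ≠ {x : B | D₂ x = 0}) :
    ∃ K : Subfield L,
      (∀ c : k, algebraMap B L (algebraMap k B c) ∈ K) ∧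
      ∃ t₁ t₂ : L,
        (∀ p : MvPolynomial (Fin 2) ↥K,
          MvPolynomial.eval₂ K.subtype ![t₁, t₂] p = 0 → p = 0) ∧
        Subfield.closure ((K : Set L) ∪ {t₁, t₂}) = (⊤ : Subfield L) := by
  obtain ⟨D₁, rfl⟩ := h₁.exists_derivation
  obtain ⟨D₂, rfl⟩ := h₂.exists_derivation
  have : CharZero B := charZero_of_injective_algebraMap (algebraMap k B).injective
  have : CharZero L := charZero_of_injective_algebraMap (IsFractionRing.injective B L)
  have hD₁ := Function.ne_iff.1 h₁0
  have hD₂ := Function.ne_iff.1 h₂0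
  refine Derivation.exists_subfield_of_locallyNilpotent htr D₁ D₂ h₁.2.2 h₂.2.2 ?_ ?_
  · by_contra! h
    exact hker (Set.ext fun b =>
      ⟨h b, D₁.map_eq_zero_of_ker_le L D₂ h₁.2.2 hD₁ hD₂ h⟩)
  · by_contra! h
    exact hker (Set.ext fun b =>
      ⟨D₂.map_eq_zero_of_ker_le L D₁ h₂.2.2 hD₂ hD₁ h, h b⟩)
end
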